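/- Fix integers m ≥ 0, n ≥ 1 and let M = 2m+1. In the ℚ(q)-algebra End(V^{⊗n}): (1) each of the operators 𝓑_i, 𝓑_{−i} (i ∈ {1/2,…,m−1/2}) and 𝓓_0^{±1}, 𝓓_r^{±1} (r ∈ {1,…,m}) commutes with each of σ_0, …, σ_{n−1}; (2) the commutant of the unital subalgebra 𝒜 generated by {𝓑_{±i}, 𝓓_0^{±1}, 𝓓_r^{±1}} equals the unital subalgebra ℋ generated by {σ_0, …, σ_{n−1}}; (3) the commutant of ℋ equals 𝒜. (This is the ıSchur duality double centralizer property between the ıquantum group U^ȷ_m and the type B Hecke algebra ℋ_B(n) acting on V^{⊗n}; in particular the operators σ_0,…,σ_{n−1} generate End_{U^ȷ_m}(V^{⊗n}).) -/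

import Mathlib

open scoped BigOperators Classical

set_option synthInstance.maxHeartbeats 1000000
set_option maxHeartbeats 1000000

noncomputable section

/-- The base field `ℚ(q)`. -/
abbrev K : Type := RatFunc ℚ

/-- The indeterminate `q`. -/
def q : K := RatFunc.X

/-- The quantum integer `[r] = (q^r - q^{-r})/(q - q^{-1})`. -/
def qint (r : ℤ) : K := (q ^ r - q ^ (-r)) / (q - q⁻¹)

/-- The quantum factorial `[r]!`. -/
def qfac : ℕ → K
  | 0 => 1
  | n+1 => qfac n * qint (n+1)

/-- The index set `𝕀_N = {-(N-1)/2, -(N-3)/2, …, (N-1)/2}` as a finite set of rationals. -/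
def II (N : ℕ) : Finset ℚ := (Finset.range N).image (fun k : ℕ => (k : ℚ) - ((N : ℚ) - 1) / 2)

theorem II_neg {N : ℕ} {a : ℚ} (h : a ∈ II N) : -a ∈ II N := by
  obtain ⟨k, hk, hv⟩ := Finset.mem_image.mp h
  rw [Finset.mem_range] at hk
  refine Finset.mem_image.mpr ⟨N - 1 - k, Finset.mem_range.mpr (by omega), ?_⟩
  have h1 : ((N - 1 - k : ℕ) : ℚ) = (N : ℚ) - 1 - (k : ℚ) := by
    have h2 : (N : ℚ) = ((N - 1 - k : ℕ) : ℚ) + (k : ℚ) + 1 := by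
      exact_mod_cast congrArg (Nat.cast : ℕ → ℚ) (by omega : N = (N - 1 - k) + k + 1)
    linarith
  rw [h1, ← hv]; ring

/-- Basis index of `V`: elements of `𝕀_M`. -/
def SubI (M : ℕ) : Type := {a : ℚ // a ∈ II M}

/-- `V^{⊗n}`: free `ℚ(q)`-vector space on `n`-tuples from `𝕀_M`. -/
abbrev TV (n M : ℕ) : Type := (Fin n → SubI M) →₀ K

/-- Basis vector `v_λ`. -/
def tT {n M : ℕ} (l : Fin n → SubI M) : TV n M := Finsupp.single l 1

/-- A "single-target" operator on `V`: `v_a ↦ c a • v_{t a}`. -/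
structure SOp where
  t : ℚ → ℚ
  c : ℚ → K

def SOp.id' : SOp := ⟨fun a => a, fun _ => 1⟩
/-- Composite `O ∘ P`. -/
def SOp.comp (O P : SOp) : SOp := ⟨fun a => O.t (P.t a), fun a => P.c a * O.c (P.t a)⟩
/-- `E_i v_a = δ(a = i+1/2) v_{a-1}`. -/
def Eop (i : ℚ) : SOp := ⟨fun a => a - 1, fun a => if a = i + 1/2 then 1 else 0⟩
/-- `F_i v_a = δ(a = i-1/2) v_{a+1}`. -/
def Fop (i : ℚ) : SOp := ⟨fun a => a + 1, fun a => if a = i - 1/2 then 1 else 0⟩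
/-- A diagonal operator `v_a ↦ q^{f a} v_a`. -/
def diagOp (f : ℚ → ℤ) : SOp := ⟨fun a => a, fun a => q ^ f a⟩
/-- `K_i^{-1}` (diagonal). -/
def Kinv (i : ℚ) : SOp := diagOp fun a => (if a = i+1/2 then 1 else 0) - (if a = i-1/2 then 1 else 0)
/-- `K_i` (diagonal). -/
def Kpos (i : ℚ) : SOp := diagOp fun a => (if a = i-1/2 then 1 else 0) - (if a = i+1/2 then 1 else 0)
/-- `k_i^{-1} = K_i^{-1} K_{-i}`. -/
def kinv (i : ℚ) : SOp := (Kinv i).comp (Kpos (-i))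
/-- `k_i = K_i K_{-i}^{-1}`. -/
def kpos (i : ℚ) : SOp := (Kpos i).comp (Kinv (-i))
/-- `(D_r D_{-r})^e` (diagonal), `e = ±1`. -/
def DDop (r : ℚ) (e : ℤ) : SOp := diagOp fun a => e * ((if a = r then 1 else 0) + (if a = -r then 1 else 0))
/-- `D_0^e` (diagonal), `e = ±1`. -/
def D0op (e : ℤ) : SOp := diagOp fun a => e * (if a = 0 then 1 else 0)

/-- Tensor product `ops 0 ⊗ ops 1 ⊗ ⋯ ⊗ ops (n-1)` of single-target operators on `V^{⊗n}`. -/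
def tensorOp {n M : ℕ} (ops : Fin n → SOp) : TV n M →ₗ[K] TV n M :=
  Finsupp.lift (TV n M) K (Fin n → SubI M) fun l =>
    if h : ∀ r, (ops r).t (l r).1 ∈ II M then
      Finsupp.single (fun r => ⟨(ops r).t (l r).1, h r⟩) (∏ r, (ops r).c (l r).1)
    else 0

/-- `𝓑_i` on `V^{⊗n}`, for `i ≠ 0` (ı-case) resp. `i ∈ {1/2,…,m-1/2}` (ȷ-case). -/
def calB (n M : ℕ) (i : ℚ) : TV n M →ₗ[K] TV n M :=
  (∑ r : Fin n, tensorOp fun s => if s < r then SOp.id' else if s = r then Fop i else Kinv i)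
  + (∑ r : Fin n, tensorOp fun s => if s < r then kinv i else if s = r then (Eop (-i)).comp (Kinv i) else Kinv i)

/-- `𝓑_0` on `V^{⊗n}` (ı-case). -/
def calB0 (n M : ℕ) : TV n M →ₗ[K] TV n M :=
  (∑ r : Fin n, tensorOp fun s => if s < r then SOp.id' else if s = r then Fop 0 else Kinv 0)
  + q⁻¹ • (∑ r : Fin n, tensorOp fun s => if s < r then SOp.id' else if s = r then (Eop 0).comp (Kinv 0) else Kinv 0)
  + tensorOp fun _ => Kinv 0

/-- `𝓑_{-i}` on `V^{⊗n}` (ȷ-case), for `i ∈ {1/2,…,m-1/2}`. -/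
def calBn (n M : ℕ) (i : ℚ) : TV n M →ₗ[K] TV n M :=
  (∑ r : Fin n, tensorOp fun s => if s < r then SOp.id' else if s = r then Fop (-i) else Kinv (-i))
  + (∑ r : Fin n, tensorOp fun s => if s < r then kpos i else if s = r then (Kinv (-i)).comp (Eop i) else Kinv (-i))

/-- `𝓓_r^e = ((D_r D_{-r})^e)^{⊗n}`. -/
def calD (n M : ℕ) (r : ℚ) (e : ℤ) : TV n M →ₗ[K] TV n M := tensorOp fun _ => DDop r e

/-- `𝓓_0^e = (D_0^e)^{⊗n}`. -/
def calD0 (n M : ℕ) (e : ℤ) : TV n M →ₗ[K] TV n M := tensorOp fun _ => D0op e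

/-- Negation on `𝕀_M`. -/
def negS {M : ℕ} (a : SubI M) : SubI M := ⟨-a.1, II_neg a.2⟩

/-- `λ · s` where `s` interchanges the tensor positions `a` and `b`. -/
def swapL {n M : ℕ} (a b : Fin n) (l : Fin n → SubI M) : Fin n → SubI M := l ∘ Equiv.swap a b

/-- The Hecke operator `σ` acting in tensor positions `a, b` (for `a < b` adjacent). -/
def sigmaI {n M : ℕ} (a b : Fin n) : TV n M →ₗ[K] TV n M :=
  Finsupp.lift (TV n M) K (Fin n → SubI M) fun l =>
    if (l a).1 < (l b).1 then tT (swapL a b l)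
    else if (l a).1 = (l b).1 then q⁻¹ • tT l
    else tT (swapL a b l) + (q⁻¹ - q) • tT l

/-- The Hecke operator `σ_0`. -/
def sigma0 {n M : ℕ} (hn : 0 < n) : TV n M →ₗ[K] TV n M :=
  Finsupp.lift (TV n M) K (Fin n → SubI M) fun l =>
    if 0 < (l ⟨0, hn⟩).1 then tT (Function.update l ⟨0, hn⟩ (negS (l ⟨0, hn⟩)))
    else if (l ⟨0, hn⟩).1 = 0 then q⁻¹ • tT l
    else tT (Function.update l ⟨0, hn⟩ (negS (l ⟨0, hn⟩))) + (q⁻¹ - q) • tT l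

/-- `σ_i`, `0 ≤ i ≤ n-1` (for `i ≥ 1` it acts on the 1-based entries `λ_i, λ_{i+1}`). -/
def sigmaB {n M : ℕ} (hn : 0 < n) (i : ℕ) (hi : i < n) : TV n M →ₗ[K] TV n M :=
  if i = 0 then sigma0 hn else sigmaI ⟨i - 1, by omega⟩ ⟨i, hi⟩

/-- The generating set of operators of the ı-quantum group `U^ȷ_m` acting on `V^{⊗n}`
(here `M = 2m+1`): the `𝓑_i, 𝓑_{-i}` (`i ∈ {1/2,…,m-1/2}`), `𝓓_0^{±1}`, and the
`𝓓_r^{±1}` (`r ∈ {1,…,m}`). -/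
def gensAj (m n : ℕ) : Set (Module.End K (TV n (2*m+1))) :=
  {O | (∃ i ∈ II (2*m), 0 < i ∧ (O = calB n (2*m+1) i ∨ O = calBn n (2*m+1) i))
     ∨ O = calD0 n (2*m+1) 1 ∨ O = calD0 n (2*m+1) (-1)
     ∨ (∃ r ∈ II (2*m+1), 0 < r ∧ (O = calD n (2*m+1) r 1 ∨ O = calD n (2*m+1) r (-1)))}

/-- The generating set `{σ_0, …, σ_{n-1}}` of the type B Hecke algebra action on `V^{⊗n}`. -/
def gensH (n M : ℕ) (hn : 0 < n) : Set (Module.End K (TV n M)) :=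
  {O | ∃ i : ℕ, ∃ hi : i < n, O = sigmaB hn i hi}

/-- The trace form `(X, Y) ↦ tr (Xᵀ Y)` on square matrices over `ℚ`. -/
def traceForm (N : Type*) [Fintype N] : LinearMap.BilinForm ℚ (Matrix N N ℚ) :=
  LinearMap.mk₂ ℚ (fun X Y => (X.transpose * Y).trace)
    (by intros; simp [add_mul]) (by intros; simp)
    (by intros; simp [mul_add]) (by intros; simp)

theorem traceForm_apply {N : Type*} [Fintype N] (X Y : Matrix N N ℚ) :
    traceForm N X Y = (X.transpose * Y).trace := rfl

theorem traceForm_isRefl (N : Type*) [Fintype N] : (traceForm N).IsRefl := by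
  intro X Y h
  rw [traceForm_apply] at h ⊢
  rw [← Matrix.trace_transpose, Matrix.transpose_mul, Matrix.transpose_transpose]
  exact h

/-- `f * E_{lk}` is the combination of the matrix units in column `k` given by column `l` of `f`. -/
theorem mul_single_one_eq_sum {N : Type*} [Fintype N] [DecidableEq N] (f : Matrix N N ℚ) (l k : N) :
    f * Matrix.single l k 1 = ∑ l', f l' l • Matrix.single l' k (1 : ℚ) := by
  ext x y
  simp [Matrix.mul_apply, Matrix.single_apply, Matrix.sum_apply, ite_and]

/-- A transpose-closed matrix algebra over `ℚ` contains its double commutant. -/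
theorem mem_of_commutes_with_commutant {N : Type*} [Fintype N] [DecidableEq N]
    (B : Subalgebra ℚ (Matrix N N ℚ)) (hB : ∀ x ∈ B, x.transpose ∈ B) (f : Matrix N N ℚ)
    (hf : ∀ g : Matrix N N ℚ, (∀ b ∈ B, b * g = g * b) → f * g = g * f) : f ∈ B := by
  set W : Submodule ℚ (Matrix N N ℚ) := Subalgebra.toSubmodule B with hW
  have hc : IsCompl W ((traceForm N).orthogonal W) := by
    rw [LinearMap.BilinForm.isCompl_orthogonal_iff_disjoint (traceForm_isRefl N),
      Submodule.disjoint_def]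
    intro x hx hx'
    have h := hx' x hx
    change (traceForm N) x x = 0 at h
    rw [traceForm_apply, ← Matrix.conjTranspose_eq_transpose_of_trivial] at h
    exact Matrix.trace_conjTranspose_mul_self_eq_zero_iff.mp h
  set P := W.projection _ hc with hP
  have hPmul : ∀ b ∈ B, ∀ X, P (b * X) = b * P X := by
    intro b hb X
    have h1 : b * P X ∈ W := B.mul_mem hb (Submodule.projection_apply_mem hc X)
    have h2 : b * (X - P X) ∈ (traceForm N).orthogonal W := by
      intro y hy
      have h3 := Submodule.sub_projection_mem hc X (b.transpose * y) (B.mul_mem (hB b hb) hy)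
      change traceForm N y _ = 0
      change traceForm N _ _ = 0 at h3
      rw [traceForm_apply] at h3 ⊢
      rwa [Matrix.transpose_mul, Matrix.transpose_transpose, Matrix.mul_assoc] at h3
    have h4 : b * X = b * P X + b * (X - P X) := by rw [← mul_add]; simp
    rw [h4, map_add, Submodule.projection_apply_of_mem_left hc h1,
      (Submodule.projection_apply_eq_zero_iff hc).mpr h2, add_zero]
  have hPf : ∀ X, P (f * X) = f * P X := by
    have key : ∀ j k : N, f * Matrix.of (fun i l => P (Matrix.single l k 1) i j)
        = Matrix.of (fun i l => P (Matrix.single l k 1) i j) * f := by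
      intro j k
      apply hf
      intro b hb
      ext i l
      have h := congrFun (congrFun (hPmul b hb (Matrix.single l k 1)) i) j
      rw [mul_single_one_eq_sum, map_sum] at h
      simp only [map_smul, Matrix.sum_apply, Matrix.smul_apply, Matrix.mul_apply,
        smul_eq_mul] at h
      simp only [Matrix.mul_apply, Matrix.of_apply]
      rw [← h]
      exact Finset.sum_congr rfl fun x _ => mul_comm _ _
    have key2 : ∀ l k, P (f * Matrix.single l k 1) = f * P (Matrix.single l k 1) := by
      intro l k
      ext i j
      have h := congrFun (congrFun (key j k) i) l
      rw [mul_single_one_eq_sum, map_sum]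
      simp only [map_smul, Matrix.sum_apply, Matrix.smul_apply, Matrix.mul_apply,
        smul_eq_mul]
      simp only [Matrix.mul_apply, Matrix.of_apply] at h
      rw [h]
      exact Finset.sum_congr rfl fun x _ => mul_comm _ _
    intro X
    induction X using Matrix.induction_on' with
    | h_zero => simp
    | h_add p q hp hq => rw [mul_add, map_add, map_add, mul_add, hp, hq]
    | h_std_basis i j x =>
      have : Matrix.single i j x = x • Matrix.single i j (1 : ℚ) := by simp
      rw [this, Matrix.mul_smul, map_smul, map_smul, key2, Matrix.mul_smul]
  have h1 := hPf 1
  rw [mul_one, Submodule.projection_apply_of_mem_left hc (x := (1 : Matrix N N ℚ)) B.one_mem,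
    mul_one] at h1
  have h2 : P f ∈ W := Submodule.projection_apply_mem hc f
  rw [h1] at h2
  exact h2

open Polynomial in
/-- The prime ideal `(q - 1)` of `ℚ[q]`. -/
def primeAtOne : Ideal ℚ[X] := Ideal.span {X - C 1}

instance : primeAtOne.IsPrime :=
  (Ideal.span_singleton_prime (Polynomial.X_sub_C_ne_zero 1)).mpr (Polynomial.prime_X_sub_C 1)

open Polynomial in
theorem mem_primeAtOne {p : ℚ[X]} : p ∈ primeAtOne ↔ p.eval 1 = 0 := by
  rw [primeAtOne, Ideal.mem_span_singleton, Polynomial.dvd_iff_isRoot, Polynomial.IsRoot]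

open Polynomial in
/-- The local ring of rational functions regular at `q = 1`. -/
def RegRing : Subalgebra ℚ[X] K :=
  Localization.subalgebra.ofField K primeAtOne.primeCompl primeAtOne.primeCompl_le_nonZeroDivisors

instance : IsLocalization.AtPrime RegRing primeAtOne :=
  Localization.subalgebra.isLocalization_ofField K primeAtOne.primeCompl
    primeAtOne.primeCompl_le_nonZeroDivisors

instance : IsFractionRing RegRing K :=
  Localization.subalgebra.isFractionRing_ofField K primeAtOne.primeCompl
    primeAtOne.primeCompl_le_nonZeroDivisors

instance : IsLocalRing RegRing := IsLocalization.AtPrime.isLocalRing RegRing primeAtOne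

instance : IsNoetherianRing RegRing :=
  IsLocalization.isNoetherianRing primeAtOne.primeCompl RegRing inferInstance

theorem isUnit_eval_of_mem_primeCompl (y : primeAtOne.primeCompl) :
    IsUnit (Polynomial.evalRingHom (1 : ℚ) (y : Polynomial ℚ)) :=
  isUnit_iff_ne_zero.mpr fun h => y.2 (mem_primeAtOne.mpr h)

/-- Evaluation at `q = 1` of rational functions regular there. -/
def evalOne : RegRing →+* ℚ :=
  IsLocalization.lift (M := primeAtOne.primeCompl) isUnit_eval_of_mem_primeCompl

theorem evalOne_algebraMap (p : Polynomial ℚ) :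
    evalOne (algebraMap (Polynomial ℚ) RegRing p) = p.eval 1 :=
  IsLocalization.lift_eq _ p

/-- `q - 1` as an element of the ring of functions regular at `q = 1`. -/
def unif : RegRing := algebraMap (Polynomial ℚ) RegRing (Polynomial.X - Polynomial.C 1)

theorem evalOne_unif : evalOne unif = 0 := by
  rw [unif, evalOne_algebraMap]; simp

theorem algebraMap_unif : algebraMap RegRing K unif = q - 1 := by
  rw [unif, ← IsScalarTower.algebraMap_apply]
  simp [q]

theorem q_ne_zero : q ≠ 0 := RatFunc.X_ne_zero

theorem q_sub_one_ne_zero : q - 1 ≠ 0 := by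
  rw [← algebraMap_unif, unif, ← IsScalarTower.algebraMap_apply]
  simpa using (RatFunc.algebraMap_ne_zero (K := ℚ) (Polynomial.X_sub_C_ne_zero (1 : ℚ)))

theorem exists_unif_mul {r : RegRing} (h : evalOne r = 0) : ∃ s, r = unif * s := by
  obtain ⟨p, d, rfl⟩ := IsLocalization.exists_mk'_eq primeAtOne.primeCompl r
  have hp : p.eval 1 = 0 := by
    have h1 := congrArg evalOne (IsLocalization.mk'_spec RegRing p d)
    rw [map_mul, h, zero_mul, evalOne_algebraMap] at h1
    exact h1.symm
  obtain ⟨c, rfl⟩ := Polynomial.dvd_iff_isRoot.mpr hp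
  exact ⟨IsLocalization.mk' RegRing c d, by rw [unif, IsLocalization.mul_mk'_eq_mk'_of_mul]⟩

/-- `x` is regular at `q = 1` with value `y`. -/
def HasValue (x : K) (y : ℚ) : Prop := ∃ r : RegRing, algebraMap RegRing K r = x ∧ evalOne r = y

namespace HasValue

theorem zero : HasValue 0 0 := ⟨0, map_zero _, map_zero _⟩
theorem one : HasValue 1 1 := ⟨1, map_one _, map_one _⟩

theorem add {x x' : K} {y y' : ℚ} (h : HasValue x y) (h' : HasValue x' y') :
    HasValue (x + x') (y + y') := by
  obtain ⟨r, rfl, rfl⟩ := h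
  obtain ⟨s, rfl, rfl⟩ := h'
  exact ⟨r + s, map_add _ _ _, map_add _ _ _⟩

theorem sub {x x' : K} {y y' : ℚ} (h : HasValue x y) (h' : HasValue x' y') :
    HasValue (x - x') (y - y') := by
  obtain ⟨r, rfl, rfl⟩ := h
  obtain ⟨s, rfl, rfl⟩ := h'
  exact ⟨r - s, map_sub _ _ _, map_sub _ _ _⟩

theorem mul {x x' : K} {y y' : ℚ} (h : HasValue x y) (h' : HasValue x' y') :
    HasValue (x * x') (y * y') := by
  obtain ⟨r, rfl, rfl⟩ := h
  obtain ⟨s, rfl, rfl⟩ := h'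
  exact ⟨r * s, map_mul _ _ _, map_mul _ _ _⟩

theorem sum {α : Type*} (s : Finset α) {x : α → K} {y : α → ℚ}
    (h : ∀ a ∈ s, HasValue (x a) (y a)) : HasValue (∑ a ∈ s, x a) (∑ a ∈ s, y a) := by
  induction s using Finset.induction_on with
  | empty => simpa using zero
  | insert a s ha ih =>
    rw [Finset.sum_insert ha, Finset.sum_insert ha]
    exact (h a (Finset.mem_insert_self a s)).add
      (ih fun b hb => h b (Finset.mem_insert_of_mem hb))

theorem prod {α : Type*} (s : Finset α) {x : α → K} {y : α → ℚ}
    (h : ∀ a ∈ s, HasValue (x a) (y a)) : HasValue (∏ a ∈ s, x a) (∏ a ∈ s, y a) := by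
  induction s using Finset.induction_on with
  | empty => simpa using one
  | insert a s ha ih =>
    rw [Finset.prod_insert ha, Finset.prod_insert ha]
    exact (h a (Finset.mem_insert_self a s)).mul
      (ih fun b hb => h b (Finset.mem_insert_of_mem hb))

theorem rat (c : ℚ) : HasValue (algebraMap ℚ K c) c := by
  refine ⟨algebraMap (Polynomial ℚ) RegRing (Polynomial.C c), ?_, ?_⟩
  · rw [← IsScalarTower.algebraMap_apply, ← Polynomial.algebraMap_eq,
      ← IsScalarTower.algebraMap_apply]
  · rw [evalOne_algebraMap, Polynomial.eval_C]

theorem indeterminate : HasValue q 1 := by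
  refine ⟨algebraMap (Polynomial ℚ) RegRing Polynomial.X, ?_, ?_⟩
  · rw [← IsScalarTower.algebraMap_apply]; simp [q]
  · rw [evalOne_algebraMap, Polynomial.eval_X]

theorem q_inv : HasValue (q)⁻¹ 1 := by
  have h : Polynomial.X ∈ primeAtOne.primeCompl := fun h => by
    have := mem_primeAtOne.mp h
    simp at this
  have hs := IsLocalization.mk'_spec RegRing (1 : Polynomial ℚ)
    (⟨Polynomial.X, h⟩ : primeAtOne.primeCompl)
  refine ⟨IsLocalization.mk' RegRing (1 : Polynomial ℚ) ⟨Polynomial.X, h⟩, ?_, ?_⟩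
  · have h1 := congrArg (algebraMap RegRing K) hs
    rw [map_mul, ← IsScalarTower.algebraMap_apply, ← IsScalarTower.algebraMap_apply] at h1
    refine eq_inv_of_mul_eq_one_left ?_
    simpa [q] using h1
  · have h1 := congrArg evalOne hs
    rw [map_mul, evalOne_algebraMap, evalOne_algebraMap] at h1
    simpa using h1

theorem q_zpow (k : ℤ) : HasValue (q ^ k) 1 := by
  have hp : ∀ (x : K) (j : ℕ), HasValue x 1 → HasValue (x ^ j) 1 := by
    intro x j hx
    induction j with
    | zero => simpa using one
    | succ j ih => simpa [pow_succ] using ih.mul hx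
  obtain ⟨j, rfl | rfl⟩ := k.eq_nat_or_neg
  · rw [zpow_natCast]; exact hp _ _ indeterminate
  · rw [zpow_neg, zpow_natCast, ← inv_pow]; exact hp _ _ q_inv

theorem unique {x : K} {y y' : ℚ} (h : HasValue x y) (h' : HasValue x y') : y = y' := by
  obtain ⟨r, rfl, rfl⟩ := h
  obtain ⟨s, hs, rfl⟩ := h'
  rw [IsFractionRing.injective RegRing K hs]

theorem q_pow_sub_one_div (k : ℕ) : HasValue ((q - 1)⁻¹ * (q ^ k - 1)) k := by
  have h : (q - 1)⁻¹ * (q ^ k - 1) = ∑ j ∈ Finset.range k, q ^ (j : ℤ) := by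
    rw [inv_mul_eq_iff_eq_mul₀ q_sub_one_ne_zero]
    simp only [zpow_natCast]
    rw [mul_geom_sum]
  rw [h]
  simpa using sum (Finset.range k) (y := fun _ => (1 : ℚ)) fun j _ => q_zpow j

end HasValue

/-- The matrix `X` is regular at `q = 1` with value `Y`. -/
def HasMatValue {ι : Type*} (X : Matrix ι ι K) (Y : Matrix ι ι ℚ) : Prop :=
  ∀ i j, HasValue (X i j) (Y i j)

/-- Two nested spaces of matrices with the same specializations at `q = 1` are equal. -/
theorem le_of_hasMatValue {ι : Type*} [Fintype ι] (W W' : Submodule K (Matrix ι ι K))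
    (hW : W ≤ W')
    (h : ∀ X ∈ W', ∀ Y, HasMatValue X Y → ∃ Z ∈ W, HasMatValue Z Y) : W' ≤ W := by
  let e : (ι → ι → RegRing) →ₗ[RegRing] Matrix ι ι K :=
    { toFun := fun X i j => algebraMap RegRing K (X i j)
      map_add' := fun X Y => funext fun i => funext fun j => map_add (algebraMap RegRing K) _ _
      map_smul' := fun c X => funext fun i => funext fun j => map_mul (algebraMap RegRing K) _ _ }
  have he : ∀ X i j, e X i j = algebraMap RegRing K (X i j) := fun _ _ _ => rfl
  let L (U : Submodule K (Matrix ι ι K)) : Submodule RegRing (ι → ι → RegRing) :=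
    (U.restrictScalars RegRing).comap e
  have hL : L W' ≤ L W := by
    refine Submodule.le_of_le_smul_of_le_jacobson_bot (I := Ideal.span {unif})
      (IsNoetherian.noetherian _) ?_ ?_
    · rw [IsLocalRing.jacobson_eq_maximalIdeal ⊥ bot_ne_top, Ideal.span_singleton_le_iff_mem,
        IsLocalRing.mem_maximalIdeal, mem_nonunits_iff]
      intro hu
      have := hu.map evalOne
      rw [evalOne_unif] at this
      exact not_isUnit_zero this
    · intro X hX
      obtain ⟨Z, hZ, hZY⟩ := h (e X) hX (fun i j => evalOne (X i j)) fun i j => ⟨X i j, rfl, rfl⟩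
      choose z hz hz' using hZY
      have hzZ : e z = Z := by ext i j; exact hz i j
      have hd : ∀ i j, ∃ s, X i j - z i j = unif * s := fun i j =>
        exists_unif_mul (by rw [map_sub, hz', sub_self])
      choose d hd using hd
      have hXd : X = z + unif • d := by
        ext i j
        have := hd i j
        simp only [Pi.add_apply, Pi.smul_apply, smul_eq_mul, ← this]
        simp
      have hdW : d ∈ L W' := by
        have h1 : e (unif • d) ∈ W' := by
          have h2 : unif • d = X - z := by rw [hXd]; simp
          rw [h2, map_sub, hzZ]
          exact W'.sub_mem hX (hW hZ)
        rw [map_smul, algebra_compatible_smul K, algebraMap_unif] at h1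
        exact (W'.smul_mem_iff q_sub_one_ne_zero).mp h1
      rw [hXd]
      refine Submodule.add_mem_sup (show e z ∈ W by rwa [hzZ]) ?_
      exact Submodule.smul_mem_smul (Ideal.mem_span_singleton_self _) hdW
  intro X hX
  obtain ⟨b, hb⟩ := IsLocalization.exist_integer_multiples_of_finite (nonZeroDivisors RegRing)
    (fun p : ι × ι => X p.1 p.2)
  choose x hx using fun i j => hb (i, j)
  have hxX : e x = algebraMap RegRing K b • X := by
    ext i j
    rw [he, hx, Matrix.smul_apply, smul_eq_mul, Algebra.smul_def]
  have hb0 : algebraMap RegRing K b ≠ 0 :=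
    IsFractionRing.to_map_ne_zero_of_mem_nonZeroDivisors b.2
  have h1 : x ∈ L W' := by
    change e x ∈ W'
    rw [hxX]; exact W'.smul_mem _ hX
  have h2 : e x ∈ W := hL h1
  rw [hxX] at h2
  exact (W.smul_mem_iff hb0).mp h2

section TensorMatrices

variable {n : ℕ} {I : Type} {R : Type} [CommRing R]

/-- The Kronecker product of a family of square matrices, indexed by tuples. -/
def tens (z : Fin n → Matrix I I R) : Matrix (Fin n → I) (Fin n → I) R :=
  fun μ l => ∏ r, z r (μ r) (l r)

/-- The derivation `∑_r id ⊗ ⋯ ⊗ y ⊗ ⋯ ⊗ id` induced by `y`. -/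
def deriv1 (n : ℕ) (y : Matrix I I R) : Matrix (Fin n → I) (Fin n → I) R :=
  ∑ r : Fin n, tens (Function.update (fun _ => 1) r y)

/-- The symmetrization of a Kronecker product. -/
def symTens (z : Fin n → Matrix I I R) : Matrix (Fin n → I) (Fin n → I) R :=
  ∑ π : Equiv.Perm (Fin n), tens (fun r => z (π r))

theorem symTens_comp (z : Fin n → Matrix I I R) (τ : Equiv.Perm (Fin n)) :
    symTens (fun r => z (τ r)) = symTens z :=
  Fintype.sum_equiv (Equiv.mulLeft τ) _ _ fun _ => rfl

theorem tens_update_apply (z : Fin n → Matrix I I R) (s : Fin n) (y : Matrix I I R)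
    (μ l : Fin n → I) :
    tens (Function.update z s y) μ l
      = y (μ s) (l s) * ∏ r ∈ Finset.univ.erase s, z r (μ r) (l r) := by
  rw [tens, ← Finset.mul_prod_erase _ _ (Finset.mem_univ s), Function.update_self]
  congr 1
  refine Finset.prod_congr rfl fun r hr => ?_
  rw [Function.update_of_ne (Finset.ne_of_mem_erase hr)]

theorem tens_update_add (z : Fin n → Matrix I I R) (s : Fin n) (x y : Matrix I I R) :
    tens (Function.update z s (x + y))
      = tens (Function.update z s x) + tens (Function.update z s y) := by
  ext μ l
  simp only [Matrix.add_apply, tens_update_apply, add_mul]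

theorem tens_update_smul (z : Fin n → Matrix I I R) (s : Fin n) (c : R) (x : Matrix I I R) :
    tens (Function.update z s (c • x)) = c • tens (Function.update z s x) := by
  ext μ l
  simp only [Matrix.smul_apply, tens_update_apply, smul_eq_mul, mul_assoc]

/-- `deriv1` as a linear map. -/
def derivLin (n : ℕ) (I R : Type) [CommRing R] :
    Matrix I I R →ₗ[R] Matrix (Fin n → I) (Fin n → I) R where
  toFun := deriv1 n
  map_add' x y := by simp only [deriv1, tens_update_add, Finset.sum_add_distrib]
  map_smul' c x := by
    simp only [deriv1, tens_update_smul, Finset.smul_sum, RingHom.id_apply]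

variable [Fintype I]

theorem tens_mul (z w : Fin n → Matrix I I R) :
    tens z * tens w = tens (fun r => z r * w r) := by
  ext μ l
  simp only [tens, Matrix.mul_apply, ← Finset.prod_mul_distrib]
  rw [Finset.prod_univ_sum, Fintype.piFinset_univ]

theorem tens_mul_update (z : Fin n → Matrix I I R) (r : Fin n) (y : Matrix I I R) :
    tens z * tens (Function.update (fun _ => 1) r y) = tens (Function.update z r (z r * y)) := by
  rw [tens_mul]
  congr 1
  funext s
  rcases eq_or_ne s r with rfl | h
  · simp
  · simp [Function.update_of_ne h]

theorem symTens_mul_deriv1 (z : Fin n → Matrix I I R) (y : Matrix I I R) :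
    symTens z * deriv1 n y = ∑ s, symTens (Function.update z s (z s * y)) := by
  simp only [symTens, deriv1]
  rw [Finset.sum_comm, Finset.sum_mul]
  refine Finset.sum_congr rfl fun π _ => ?_
  rw [Finset.mul_sum]
  refine Fintype.sum_equiv π _ _ fun r => ?_
  rw [tens_mul_update]
  congr 1
  funext s
  rcases eq_or_ne s r with rfl | h
  · simp
  · rw [Function.update_of_ne h, Function.update_of_ne (fun h' => h (π.injective h'))]

theorem deriv1_commutator (x y : Matrix I I R) :
    deriv1 n x * deriv1 n y - deriv1 n y * deriv1 n x = deriv1 n (x * y - y * x) := by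
  have hlin : deriv1 n (x * y - y * x) = deriv1 n (x * y) - deriv1 n (y * x) :=
    map_sub (derivLin n I R) _ _
  rw [hlin]
  have h : ∀ u v : Matrix I I R, deriv1 n u * deriv1 n v = deriv1 n (u * v) +
      ∑ r, ∑ s ∈ Finset.univ.erase r,
        tens (Function.update (Function.update (fun _ => 1) r u) s v) := by
    intro u v
    simp only [deriv1]
    rw [Finset.sum_mul, ← Finset.sum_add_distrib]
    refine Finset.sum_congr rfl fun r _ => ?_
    rw [Finset.mul_sum, ← Finset.add_sum_erase _ _ (Finset.mem_univ r)]
    congr 1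
    · rw [tens_mul_update]; simp
    · refine Finset.sum_congr rfl fun s hs => ?_
      rw [tens_mul_update, Function.update_of_ne (Finset.ne_of_mem_erase hs), one_mul]
  rw [h, h, add_sub_add_comm]
  have h2 : ∑ r : Fin n, ∑ s ∈ Finset.univ.erase r,
        tens (Function.update (Function.update (fun _ => 1) r x) s y)
      = ∑ r : Fin n, ∑ s ∈ Finset.univ.erase r,
        tens (Function.update (Function.update (fun _ => 1) r y) s x) := by
    rw [Finset.sum_comm' (t' := Finset.univ) (s' := fun s => Finset.univ.erase s)
      (by intro a b; simp [eq_comm])]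
    refine Finset.sum_congr rfl fun r _ => Finset.sum_congr rfl fun s hs => ?_
    rw [Function.update_comm (Finset.ne_of_mem_erase hs)]
  rw [h2, sub_self, add_zero]

end TensorMatrices

section SymmetricInvariants

variable {n : ℕ} {I : Type} [Fintype I]

/-- An algebra containing the derivations of all elements of a monoid `G` of matrices contains all
symmetrized Kronecker products of elements of `G`. -/
theorem symTens_mem (A : Subalgebra ℚ (Matrix (Fin n → I) (Fin n → I) ℚ))
    (G : Submonoid (Matrix I I ℚ)) (hG : ∀ y ∈ G, deriv1 n y ∈ A)
    (z : Fin n → Matrix I I ℚ) (hz : ∀ r, z r ∈ G) : symTens z ∈ A := by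
  have key : ∀ (S : Finset (Fin n)) (z : Fin n → Matrix I I ℚ), (∀ r, z r ∈ G) →
      (∀ r ∉ S, z r = 1) → symTens z ∈ A := by
    intro S
    induction S using Finset.induction_on with
    | empty =>
      intro z _ h1
      have hz1 : z = fun _ => 1 := funext fun r => h1 r (Finset.notMem_empty r)
      have htens : tens (fun _ : Fin n => (1 : Matrix I I ℚ)) = 1 := by
        ext μ l
        simp only [tens, Matrix.one_apply, Finset.prod_ite_zero, Finset.prod_const_one]
        simp [funext_iff]
      rw [hz1, symTens]
      exact A.sum_mem fun _ _ => htens ▸ A.one_mem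
    | insert s₀ S hs₀ ih =>
      intro z hz h1
      set z' := Function.update z s₀ 1 with hz'
      have hz's₀ : z' s₀ = 1 := by simp [hz']
      have hz'G : ∀ r, z' r ∈ G := by
        intro r
        rcases eq_or_ne r s₀ with rfl | h
        · rw [hz's₀]; exact G.one_mem
        · rw [hz', Function.update_of_ne h]; exact hz r
      have hz'1 : ∀ r ∉ S, z' r = 1 := by
        intro r hr
        rcases eq_or_ne r s₀ with rfl | h
        · exact hz's₀
        · rw [hz', Function.update_of_ne h]
          exact h1 r (by simp [h, hr])
      have hin : ∀ s ∈ S, symTens (Function.update z' s (z' s * z s₀)) ∈ A := by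
        intro s hs
        apply ih
        · intro r
          rcases eq_or_ne r s with rfl | h
          · rw [Function.update_self]; exact G.mul_mem (hz'G r) (hz s₀)
          · rw [Function.update_of_ne h]; exact hz'G r
        · intro r hr
          rw [Function.update_of_ne (fun h => hr (by rw [h]; exact hs))]
          exact hz'1 r hr
      have hout : ∀ s ∈ Sᶜ, symTens (Function.update z' s (z' s * z s₀)) = symTens z := by
        intro s hs
        have hs' := Finset.mem_compl.mp hs
        rw [hz'1 s hs', one_mul, ← symTens_comp z (Equiv.swap s₀ s)]
        congr 1
        funext r
        rcases eq_or_ne r s with rfl | h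
        · simp
        · rw [Function.update_of_ne h]
          rcases eq_or_ne r s₀ with rfl | h'
          · rw [Equiv.swap_apply_left, hz's₀]
            exact (h1 s (by simp [h.symm, hs'])).symm
          · rw [Equiv.swap_apply_of_ne_of_ne h' h, hz', Function.update_of_ne h']
      have hsum := symTens_mul_deriv1 z' (z s₀)
      rw [← Finset.sum_add_sum_compl S, Finset.sum_congr rfl hout, Finset.sum_const] at hsum
      have hmem : Sᶜ.card • symTens z ∈ A := by
        rw [← sub_eq_iff_eq_add'.mpr hsum]
        exact A.sub_mem (A.mul_mem (ih z' hz'G hz'1) (hG _ (hz s₀))) (A.sum_mem hin)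
      have hcard : ((Sᶜ.card : ℕ) : ℚ) ≠ 0 := by
        rw [Nat.cast_ne_zero]
        exact Finset.card_ne_zero_of_mem (Finset.mem_compl.mpr hs₀)
      rw [← Nat.cast_smul_eq_nsmul ℚ] at hmem
      exact (A.toSubmodule.smul_mem_iff hcard).mp hmem
  exact key Finset.univ z hz (by simp)

/-- The sum of a matrix unit and its image under an involution of the index set. -/
def signedUnit (ng : I → I) (a b : I) : Matrix I I ℚ :=
  Matrix.single a b 1 + Matrix.single (ng a) (ng b) 1

/-- A matrix invariant under permutations of tuples and under sign changes lies in every algebra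
containing the derivations of the sign-invariant matrices. -/
theorem mem_of_invariant (ng : I → I) (hng : Function.Involutive ng)
    (A : Subalgebra ℚ (Matrix (Fin n → I) (Fin n → I) ℚ))
    (hA : ∀ a b, deriv1 n (signedUnit ng a b) ∈ A)
    (X : Matrix (Fin n → I) (Fin n → I) ℚ)
    (hperm : ∀ (π : Equiv.Perm (Fin n)) μ l, X (μ ∘ π) (l ∘ π) = X μ l)
    (hsign : ∀ (t : Finset (Fin n)) μ l, X (fun r => if r ∈ t then μ r else ng (μ r))
      (fun r => if r ∈ t then l r else ng (l r)) = X μ l) : X ∈ A := by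
  let G : Submonoid (Matrix I I ℚ) :=
    { carrier := {x | ∀ a b, x (ng a) (ng b) = x a b}
      one_mem' := fun a b => by simp [Matrix.one_apply, hng.injective.eq_iff]
      mul_mem' := fun {x y} hx hy a b => by
        simp only [Matrix.mul_apply]
        rw [← Equiv.sum_comp hng.toPerm]
        exact Finset.sum_congr rfl fun c _ => by
          rw [Function.Involutive.coe_toPerm, hx, hy] }
  have hGA : ∀ y ∈ G, deriv1 n y ∈ A := by
    intro y hy
    have h2 : (2 : ℚ) • y = ∑ a, ∑ b, y a b • signedUnit ng a b := by
      simp only [signedUnit, smul_add, Finset.sum_add_distrib]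
      have e1 : ∑ a, ∑ b, y a b • Matrix.single a b (1 : ℚ) = y := by
        conv_rhs => rw [Matrix.matrix_eq_sum_single y]
        simp
      have e2 : ∑ a, ∑ b, y a b • Matrix.single (ng a) (ng b) (1 : ℚ) = y := by
        conv_rhs => rw [← e1]
        refine Fintype.sum_equiv hng.toPerm _ _ fun a => ?_
        refine Fintype.sum_equiv hng.toPerm _ _ fun b => ?_
        rw [Function.Involutive.coe_toPerm, hy]
      rw [e1, e2, two_smul]
    have h3 : derivLin n I ℚ ((2 : ℚ) • y) ∈ A := by
      rw [h2]
      simp only [map_sum, map_smul]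
      exact A.sum_mem fun a _ => A.sum_mem fun b _ => A.smul_mem (hA a b) _
    rw [map_smul] at h3
    exact (A.toSubmodule.smul_mem_iff two_ne_zero).mp h3
  have hu : ∀ a b, signedUnit ng a b ∈ G := by
    intro a b c d
    simp only [signedUnit, Matrix.add_apply, Matrix.single_apply, hng.injective.eq_iff,
      hng.eq_iff]
    rw [add_comm]
  have hY : ∑ μ, ∑ l, X μ l • tens (fun r => signedUnit ng (μ r) (l r)) = (2 ^ n : ℚ) • X := by
    ext α β
    simp only [Matrix.sum_apply, Matrix.smul_apply, smul_eq_mul]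
    have hprod : ∀ μ l, tens (fun r => signedUnit ng (μ r) (l r)) α β
        = ∑ t : Finset (Fin n), if μ = (fun r => if r ∈ t then α r else ng (α r)) ∧
          l = (fun r => if r ∈ t then β r else ng (β r)) then (1 : ℚ) else 0 := by
      intro μ l
      simp only [tens, signedUnit, Matrix.add_apply, Matrix.single_apply]
      rw [Finset.prod_add, Finset.powerset_univ]
      refine Finset.sum_congr rfl fun t _ => ?_
      rw [Finset.prod_ite_zero, Finset.prod_ite_zero, ite_zero_mul_ite_zero]
      simp only [Finset.prod_const_one, mul_one]
      refine if_congr ?_ rfl rfl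
      simp only [funext_iff, Finset.mem_sdiff, Finset.mem_univ, true_and]
      constructor
      · rintro ⟨h1, h2⟩
        refine ⟨fun r => ?_, fun r => ?_⟩ <;> split_ifs with h
        · exact (h1 r h).1
        · rw [← (h2 r h).1, hng]
        · exact (h1 r h).2
        · rw [← (h2 r h).2, hng]
      · rintro ⟨h1, h2⟩
        refine ⟨fun r h => ?_, fun r h => ?_⟩
        · simp [h1 r, h2 r, h]
        · simp [h1 r, h2 r, h, hng _]
    simp only [hprod, Finset.mul_sum]
    have hswap : ∑ μ, ∑ l, ∑ t : Finset (Fin n),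
        X μ l * (if μ = (fun r => if r ∈ t then α r else ng (α r)) ∧
          l = (fun r => if r ∈ t then β r else ng (β r)) then (1 : ℚ) else 0)
        = ∑ t : Finset (Fin n), X α β := by
      rw [Finset.sum_congr rfl fun μ _ => Finset.sum_comm, Finset.sum_comm]
      refine Finset.sum_congr rfl fun t _ => ?_
      simp only [ite_and, mul_ite, mul_one, mul_zero, Finset.sum_ite_irrel,
        Finset.sum_const_zero, Finset.sum_ite_eq', Finset.mem_univ, if_true]
      exact hsign t α β
    rw [hswap]
    simp
  have hsym : ∑ μ, ∑ l, X μ l • symTens (fun r => signedUnit ng (μ r) (l r))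
      = ((n.factorial : ℚ) * 2 ^ n) • X := by
    simp only [symTens, Finset.smul_sum]
    rw [Finset.sum_congr rfl fun μ _ => Finset.sum_comm, Finset.sum_comm]
    have : ∀ π : Equiv.Perm (Fin n), ∑ μ, ∑ l, X μ l • tens (fun r =>
        signedUnit ng (μ (π r)) (l (π r))) = (2 ^ n : ℚ) • X := by
      intro π
      rw [← hY]
      refine Fintype.sum_equiv (Equiv.arrowCongr π.symm (Equiv.refl I)) _ _ fun μ => ?_
      refine Fintype.sum_equiv (Equiv.arrowCongr π.symm (Equiv.refl I)) _ _ fun l => ?_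
      rw [← hperm π μ l]
      rfl
    rw [Finset.sum_congr rfl fun π _ => this π, Finset.sum_const, Finset.card_univ,
      Fintype.card_perm, Fintype.card_fin, ← Nat.cast_smul_eq_nsmul ℚ, smul_smul]
  have hmem : ((n.factorial : ℚ) * 2 ^ n) • X ∈ A := by
    rw [← hsym]
    exact A.sum_mem fun μ _ => A.sum_mem fun l _ =>
      A.smul_mem (symTens_mem A G hGA _ fun r => hu _ _) _
  exact (A.toSubmodule.smul_mem_iff (by positivity)).mp hmem

end SymmetricInvariants

instance (M : ℕ) : Fintype (SubI M) := inferInstanceAs (Fintype {a : ℚ // a ∈ II M})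

theorem intCast_mem_II {m : ℕ} {z : ℤ} (h : |z| ≤ m) : (z : ℚ) ∈ II (2 * m + 1) := by
  obtain ⟨h1, h2⟩ := abs_le.mp h
  obtain ⟨k, hk⟩ := Int.eq_ofNat_of_zero_le (by omega : 0 ≤ z + m)
  refine Finset.mem_image.mpr ⟨k, Finset.mem_range.mpr (by omega), ?_⟩
  have hz : z = (k : ℤ) - m := by omega
  rw [hz]
  push_cast
  ring

theorem exists_int_of_mem_II {m : ℕ} {a : ℚ} (h : a ∈ II (2 * m + 1)) :
    ∃ z : ℤ, |z| ≤ m ∧ a = z := by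
  obtain ⟨k, hk, rfl⟩ := Finset.mem_image.mp h
  rw [Finset.mem_range] at hk
  refine ⟨k - m, abs_le.mpr ⟨by omega, by omega⟩, ?_⟩
  push_cast
  ring

theorem exists_nat_of_mem_II_even {m : ℕ} {i : ℚ} (h : i ∈ II (2 * m)) (hi : 0 < i) :
    ∃ a : ℕ, a < m ∧ i = a + 1 / 2 := by
  obtain ⟨k, hk, rfl⟩ := Finset.mem_image.mp h
  rw [Finset.mem_range] at hk
  have hm : m ≤ k := by
    by_contra hlt
    have h1 : (k : ℚ) + 1 ≤ m := by exact_mod_cast (not_le.mp hlt)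
    push_cast at hi
    linarith
  obtain ⟨j, rfl⟩ := Nat.exists_eq_add_of_le hm
  refine ⟨j, by omega, ?_⟩
  push_cast
  ring

theorem half_mem_II {m a : ℕ} (h : a < m) : (a : ℚ) + 1 / 2 ∈ II (2 * m) := by
  refine Finset.mem_image.mpr ⟨m + a, Finset.mem_range.mpr (by omega), ?_⟩
  push_cast
  ring

/-- The element of `SubI M` with value `a`. -/
def SubI.mk {M : ℕ} (a : ℚ) (h : a ∈ II M) : SubI M := ⟨a, h⟩

/-- The basis index with integer value `z`. -/
def idx (m : ℕ) (z : ℤ) : SubI (2 * m + 1) :=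
  if h : |z| ≤ m then SubI.mk z (intCast_mem_II h) else SubI.mk (0 : ℤ) (intCast_mem_II (by simp))

theorem idx_val {m : ℕ} {z : ℤ} (h : |z| ≤ m) : (idx m z).1 = z := by
  rw [idx, dif_pos h, SubI.mk]

theorem exists_idx {m : ℕ} (a : SubI (2 * m + 1)) : ∃ z : ℤ, |z| ≤ m ∧ a = idx m z := by
  obtain ⟨z, hz, h⟩ := exists_int_of_mem_II a.2
  exact ⟨z, hz, Subtype.ext (h.trans (idx_val hz).symm)⟩

theorem idx_inj {m : ℕ} {a b : ℤ} (ha : |a| ≤ m) (hb : |b| ≤ m) : idx m a = idx m b ↔ a = b := by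
  refine ⟨fun h => ?_, fun h => h ▸ rfl⟩
  have := congrArg Subtype.val h
  rw [idx_val ha, idx_val hb] at this
  exact_mod_cast this

theorem negS_idx {m : ℕ} {a : ℤ} (ha : |a| ≤ m) : negS (idx m a) = idx m (-a) := by
  refine Subtype.ext ?_
  change -(idx m a).1 = _
  rw [idx_val ha, idx_val (by rwa [abs_neg])]
  simp

theorem negS_involutive {M : ℕ} : Function.Involutive (negS (M := M)) :=
  fun a => Subtype.ext (neg_neg a.1)

/-- The sign-symmetrized matrix unit with integer labels. -/
def sgnUnit (m : ℕ) (a b : ℤ) : Matrix (SubI (2 * m + 1)) (SubI (2 * m + 1)) ℚ :=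
  signedUnit negS (idx m a) (idx m b)

theorem sgnUnit_eq {m : ℕ} {a b : ℤ} (ha : |a| ≤ m) (hb : |b| ≤ m) :
    sgnUnit m a b = Matrix.single (idx m a) (idx m b) 1
      + Matrix.single (idx m (-a)) (idx m (-b)) 1 := by
  rw [sgnUnit, signedUnit, negS_idx ha, negS_idx hb]

theorem sgnUnit_neg {m : ℕ} {a b : ℤ} (ha : |a| ≤ m) (hb : |b| ≤ m) :
    sgnUnit m (-a) (-b) = sgnUnit m a b := by
  rw [sgnUnit_eq ha hb, sgnUnit_eq (by rwa [abs_neg]) (by rwa [abs_neg]), neg_neg, neg_neg]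
  exact add_comm (Matrix.single (idx m (-a)) (idx m (-b)) (1 : ℚ)) _

theorem sgnUnit_transpose {m : ℕ} (a b : ℤ) :
    (sgnUnit m a b).transpose = sgnUnit m b a := by
  simp [sgnUnit, signedUnit, Matrix.transpose_single]

theorem sgnUnit_mul {m : ℕ} {a b c d : ℤ} (ha : |a| ≤ m) (hb : |b| ≤ m) (hc : |c| ≤ m)
    (hd : |d| ≤ m) : sgnUnit m a b * sgnUnit m c d
      = (if b = c then sgnUnit m a d else 0) + (if b = -c then sgnUnit m a (-d) else 0) := by
  have hsing : ∀ {a b c d : ℤ}, |b| ≤ m → |c| ≤ m →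
      Matrix.single (idx m a) (idx m b) (1 : ℚ) * Matrix.single (idx m c) (idx m d) 1
        = if b = c then Matrix.single (idx m a) (idx m d) 1 else 0 := by
    intro a b c d hb hc
    split_ifs with h
    · subst h; simp
    · exact Matrix.single_mul_single_of_ne _ _ _ _ (by rwa [Ne, idx_inj hb hc]) _
  have hb' : |-b| ≤ m := by rwa [abs_neg]
  have hc' : |-c| ≤ m := by rwa [abs_neg]
  have hd' : |-d| ≤ m := by rwa [abs_neg]
  rw [sgnUnit_eq ha hb, sgnUnit_eq hc hd, sgnUnit_eq ha hd, sgnUnit_eq ha hd', add_mul, mul_add,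
    mul_add, hsing hb hc, hsing hb hc', hsing hb' hc, hsing hb' hc']
  simp only [neg_eq_iff_eq_neg, neg_neg]
  split_ifs <;> abel

/-- A space of matrices closed under commutators and containing the diagonal and the adjacent
sign-symmetrized units contains the ones labelled `(a, b)` with `|b| ≤ a`. -/
theorem sgnUnit_mem_of_abs_le {m : ℕ}
    (L : Submodule ℚ (Matrix (SubI (2 * m + 1)) (SubI (2 * m + 1)) ℚ))
    (hL : ∀ x ∈ L, ∀ y ∈ L, x * y - y * x ∈ L)
    (hdiag : ∀ a : ℕ, a ≤ m → sgnUnit m a a ∈ L)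
    (hup : ∀ a : ℕ, a < m → sgnUnit m (a + 1) a ∈ L)
    (hdown : ∀ a : ℕ, a < m → sgnUnit m a (a + 1) ∈ L) :
    ∀ a : ℕ, a ≤ m → ∀ b : ℤ, |b| ≤ a → sgnUnit m a b ∈ L := by
  intro a
  induction a with
  | zero =>
    intro _ b hb
    have hb0 : b = 0 := by simpa using hb
    subst hb0
    simpa using hdiag 0 (Nat.zero_le m)
  | succ a ih =>
    intro ham b hb
    have ha : |(a : ℤ)| ≤ m := by rw [abs_of_nonneg (by omega)]; omega
    have ha1 : |(a : ℤ) + 1| ≤ m := by rw [abs_of_nonneg (by omega)]; omega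
    push_cast at hb ⊢
    have hbm : |b| ≤ m := hb.trans (by omega)
    rcases Nat.eq_zero_or_pos a with rfl | hpos
    · have h1 := hup 0 (by omega)
      have h2 := hdown 0 (by omega)
      have h3 := hdiag 1 (by omega)
      have h0 := hdiag 0 (by omega)
      simp only [Nat.cast_zero, zero_add, Nat.cast_one] at *
      have hbr := hL _ h1 _ h2
      rw [sgnUnit_mul ha1 ha ha ha1, sgnUnit_mul ha ha1 ha1 ha] at hbr
      simp only [neg_zero, if_true] at hbr
      rw [if_neg (by norm_num : ¬ (1 : ℤ) = -1), add_zero] at hbr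
      have h4 : sgnUnit m 1 (-1) ∈ L := by
        have := L.add_mem (L.sub_mem hbr h3) h0
        convert this using 1
        abel
      have : b = -1 ∨ b = 0 ∨ b = 1 := by
        have := abs_le.mp hb
        omega
      rcases this with rfl | rfl | rfl
      · exact h4
      · exact h1
      · exact h3
    · have hlt : ∀ c : ℤ, |c| ≤ a → sgnUnit m (a + 1) c ∈ L := by
        intro c hc
        have hcm : |c| ≤ m := hc.trans (by omega)
        have hc' := abs_le.mp hc
        have hbr := hL _ (hup a (by omega)) _ (ih (by omega) c hc)
        rw [sgnUnit_mul ha1 ha ha hcm, sgnUnit_mul ha hcm ha1 ha, if_pos rfl,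
          if_neg (by omega), if_neg (by omega), if_neg (by omega), add_zero, add_zero,
          sub_zero] at hbr
        exact hbr
      have hb' := abs_le.mp hb
      by_cases hba : |b| ≤ a
      · exact hlt b hba
      · have : b = a + 1 ∨ b = -(a + 1) := by
          by_contra hcon
          exact hba (abs_le.mpr ⟨by omega, by omega⟩)
        rcases this with rfl | rfl
        · exact_mod_cast hdiag (a + 1) ham
        · have hna : |-(a : ℤ)| ≤ m := by rwa [abs_neg]
          have hna1 : |-((a : ℤ) + 1)| ≤ m := by rwa [abs_neg]
          have h1 := hlt (-a) (by simp)
          have h2 : sgnUnit m (-a) (-(a + 1)) ∈ L := by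
            rw [sgnUnit_neg ha ha1]; exact hdown a (by omega)
          have h3 := ih (by omega) (-a) (by simp)
          have hbr := hL _ h1 _ h2
          rw [sgnUnit_mul ha1 hna hna hna1, sgnUnit_mul hna hna1 ha1 hna, if_pos rfl,
            if_neg (by omega), if_neg (by omega), if_pos rfl, add_zero, zero_add, neg_neg] at hbr
          rw [← sgnUnit_neg ha hna, neg_neg] at h3
          have := L.add_mem hbr h3
          rwa [sub_add_cancel] at this

/-- A space of matrices closed under commutators and containing the diagonal and the adjacent
sign-symmetrized units contains all sign-symmetrized units. -/
theorem signedUnit_mem {m : ℕ}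
    (L : Submodule ℚ (Matrix (SubI (2 * m + 1)) (SubI (2 * m + 1)) ℚ))
    (hL : ∀ x ∈ L, ∀ y ∈ L, x * y - y * x ∈ L)
    (hdiag : ∀ a : ℕ, a ≤ m → sgnUnit m a a ∈ L)
    (hup : ∀ a : ℕ, a < m → sgnUnit m (a + 1) a ∈ L)
    (hdown : ∀ a : ℕ, a < m → sgnUnit m a (a + 1) ∈ L) (a b : SubI (2 * m + 1)) :
    signedUnit negS a b ∈ L := by
  have h1 := sgnUnit_mem_of_abs_le L hL hdiag hup hdown
  have h2 := sgnUnit_mem_of_abs_le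
    (L.comap (Matrix.transposeLinearEquiv _ _ ℚ ℚ).toLinearMap) (by
      intro x hx y hy
      have := hL _ hy _ hx
      simpa [Matrix.transpose_sub, Matrix.transpose_mul] using this)
    (fun a ha => by simpa [sgnUnit_transpose] using hdiag a ha)
    (fun a ha => by simpa [sgnUnit_transpose] using hdown a ha)
    (fun a ha => by simpa [sgnUnit_transpose] using hup a ha)
  have h2' : ∀ a : ℕ, a ≤ m → ∀ b : ℤ, |b| ≤ a → sgnUnit m b a ∈ L := fun a ha b hb => by
    simpa [sgnUnit_transpose] using h2 a ha b hb
  have hnat : ∀ (a : ℕ) (b : ℤ), a ≤ m → |b| ≤ m → sgnUnit m a b ∈ L := by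
    intro a b ha hb
    by_cases hab : |b| ≤ a
    · exact h1 a ha b hab
    · obtain ⟨k, rfl | rfl⟩ := b.eq_nat_or_neg
      · refine h2' k (by simpa using hb) a ?_
        simp at hab ⊢; omega
      · rw [← sgnUnit_neg (by simpa using ha) hb, neg_neg]
        refine h2' k (by simpa using hb) (-a) ?_
        simp at hab ⊢; omega
  obtain ⟨x, hx, rfl⟩ := exists_idx a
  obtain ⟨y, hy, rfl⟩ := exists_idx b
  change sgnUnit m x y ∈ L
  obtain ⟨k, rfl | rfl⟩ := x.eq_nat_or_neg
  · exact hnat k y (by simpa using hx) hy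
  · rw [← sgnUnit_neg hx hy, neg_neg]
    exact hnat k (-y) (by simpa using hx) (by rwa [abs_neg])

/-- Eigenvalue of `K_i⁻¹` on `v_u` for `i = p + 1/2`. -/
def kap (p u : ℤ) : K := if u = p + 1 then q else if u = p then q⁻¹ else 1

/-- The diagonal coefficient of the type A Hecke operator relative to the place permutation. -/
def hePair (u v : ℤ) : K := if u < v then 0 else if u = v then q⁻¹ - 1 else q⁻¹ - q

/-- The diagonal coefficient of `σ_0` relative to the sign change. -/
def heSign (u : ℤ) : K := if 0 < u then 0 else if u = 0 then q⁻¹ - 1 else q⁻¹ - q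

theorem raise_pair (hq : q ≠ 0) (p x y u v : ℤ) (Y : ℤ → ℤ → ℤ → ℤ → K)
    (hY : Y = fun x y u v =>
      (if x = p + 1 ∧ u = p then (1 : K) else 0) * (if y = v then kap p y else 0)
      + (if x = u then 1 else 0) * (if y = p + 1 ∧ v = p then 1 else 0)) :
    Y y x u v + hePair x y * Y x y u v = Y x y v u + Y x y u v * hePair u v := by
  have hq' : q * q⁻¹ = 1 := mul_inv_cancel₀ hq
  subst hY
  simp only [hePair, kap]
  grind

theorem lower_pair (hq : q ≠ 0) (d : ℤ → K) (c : K) (p x y u v : ℤ) (Y : ℤ → ℤ → ℤ → ℤ → K)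
    (hY : Y = fun x y u v =>
      (if x = -p - 1 ∧ u = -p then c else 0) * (if y = v then d y else 0)
      + (if x = u then d x * (kap (-p - 1) x)⁻¹ else 0) * (if y = -p - 1 ∧ v = -p then c else 0)) :
    Y y x u v + hePair x y * Y x y u v = Y x y v u + Y x y u v * hePair u v := by
  have hq' : q * q⁻¹ = 1 := mul_inv_cancel₀ hq
  subst hY
  simp only [hePair, kap]
  grind

theorem sign_pair (hq : q ≠ 0) (p x u : ℤ) (Y : ℤ → ℤ → K)
    (hY : Y = fun x u =>
      (if x = p + 1 ∧ u = p then (1 : K) else 0)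
      + (if x = -p - 1 ∧ u = -p then (if p = 0 then q⁻¹ else if p = -1 then q else 1) else 0)) :
    Y (-x) u + heSign x * Y x u = Y x (-u) + Y x u * heSign u := by
  have hq' : q * q⁻¹ = 1 := mul_inv_cancel₀ hq
  subst hY
  simp only [heSign]
  rcases eq_or_ne p 0 with rfl | h0
  · grind (splits := 30)
  rcases eq_or_ne p (-1) with rfl | h1
  · grind (splits := 30)
  rw [if_neg h0, if_neg h1]
  grind (splits := 30)

section Invariance

variable {n : ℕ} {I : Type}

/-- The `r`-th summand pattern `L ⊗ ⋯ ⊗ L ⊗ y ⊗ R ⊗ ⋯ ⊗ R`, with `y` in position `r`. -/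
def stringAt {R : Type} (A y B : Matrix I I R) (r s : Fin n) : Matrix I I R :=
  if s < r then A else if s = r then y else B

/-- The sum over all positions of `y` of `A ⊗ ⋯ ⊗ A ⊗ y ⊗ B ⊗ ⋯ ⊗ B`. -/
def stringSum (n : ℕ) {R : Type} [CommRing R] (A y B : Matrix I I R) :
    Matrix (Fin n → I) (Fin n → I) R :=
  ∑ r : Fin n, tens (stringAt A y B r)

/-- `X` commutes with the operator `v_l ↦ v_{s l} + h(l) v_l`. -/
def TwistInv {ι : Type*} (s : ι → ι) (h : ι → K) (X : Matrix ι ι K) : Prop :=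
  ∀ μ l, X (s μ) l + h μ * X μ l = X μ (s l) + X μ l * h l

theorem TwistInv.add {ι : Type*} {s : ι → ι} {h : ι → K} {X Y : Matrix ι ι K}
    (hX : TwistInv s h X) (hY : TwistInv s h Y) : TwistInv s h (X + Y) := by
  intro μ l
  have h1 := hX μ l
  have h2 := hY μ l
  simp only [Matrix.add_apply]
  linear_combination h1 + h2

theorem TwistInv.sum {ι α : Type*} {s : ι → ι} {h : ι → K} {X : α → Matrix ι ι K}
    (T : Finset α) (hX : ∀ r ∈ T, TwistInv s h (X r)) : TwistInv s h (∑ r ∈ T, X r) := by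
  induction T using Finset.induction_on with
  | empty => intro μ l; simp
  | insert a T ha ih =>
    rw [Finset.sum_insert ha]
    exact (hX a (Finset.mem_insert_self a T)).add
      (ih fun r hr => hX r (Finset.mem_insert_of_mem hr))

theorem tens_eq_mul_mul {R : Type} [CommRing R] {a b : Fin n} (hab : a ≠ b)
    (z : Fin n → Matrix I I R) (μ l : Fin n → I) :
    tens z μ l = z a (μ a) (l a) * z b (μ b) (l b)
      * ∏ r ∈ (Finset.univ.erase a).erase b, z r (μ r) (l r) := by
  rw [tens, ← Finset.mul_prod_erase _ _ (Finset.mem_univ a),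
    ← Finset.mul_prod_erase _ _ (Finset.mem_erase.mpr ⟨hab.symm, Finset.mem_univ b⟩), mul_assoc]

/-- A matrix acting in positions `a`, `b` through `Y` and independently elsewhere commutes with
the operator in those positions as soon as `Y` does. -/
theorem twistInv_pair {a b : Fin n} (h : I → I → K) (X : Matrix (Fin n → I) (Fin n → I) K)
    (Y : I → I → I → I → K) (z : Fin n → Matrix I I K)
    (hX : ∀ μ l, X μ l = Y (μ a) (μ b) (l a) (l b)
      * ∏ r ∈ (Finset.univ.erase a).erase b, z r (μ r) (l r))
    (hY : ∀ x y u v, Y y x u v + h x y * Y x y u v = Y x y v u + Y x y u v * h u v) :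
    TwistInv (fun l => l ∘ Equiv.swap a b) (fun l => h (l a) (l b)) X := by
  intro μ l
  have hP : ∀ μ l : Fin n → I, ∏ r ∈ (Finset.univ.erase a).erase b,
      z r ((μ ∘ Equiv.swap a b) r) (l r)
        = ∏ r ∈ (Finset.univ.erase a).erase b, z r (μ r) (l r) := by
    intro μ l
    refine Finset.prod_congr rfl fun r hr => ?_
    rw [Finset.mem_erase, Finset.mem_erase] at hr
    rw [Function.comp_apply, Equiv.swap_apply_of_ne_of_ne hr.2.1 hr.1]
  have hP' : ∀ μ l : Fin n → I, ∏ r ∈ (Finset.univ.erase a).erase b,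
      z r (μ r) ((l ∘ Equiv.swap a b) r)
        = ∏ r ∈ (Finset.univ.erase a).erase b, z r (μ r) (l r) := by
    intro μ l
    refine Finset.prod_congr rfl fun r hr => ?_
    rw [Finset.mem_erase, Finset.mem_erase] at hr
    rw [Function.comp_apply, Equiv.swap_apply_of_ne_of_ne hr.2.1 hr.1]
  rw [hX, hX, hX, hP, hP']
  simp only [Function.comp_apply, Equiv.swap_apply_left, Equiv.swap_apply_right]
  linear_combination (∏ r ∈ (Finset.univ.erase a).erase b, z r (μ r) (l r))
    * hY (μ a) (μ b) (l a) (l b)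

theorem twistInv_tens_diagonal {a b : Fin n} (hab : a ≠ b) (h : I → I → K)
    (z : Fin n → Matrix I I K) (d : I → K) (ha : z a = Matrix.diagonal d)
    (hb : z b = Matrix.diagonal d) :
    TwistInv (fun l => l ∘ Equiv.swap a b) (fun l => h (l a) (l b)) (tens z) := by
  refine twistInv_pair h _ (fun x y u v => z a x u * z b y v) z
    (fun μ l => tens_eq_mul_mul hab z μ l) fun x y u v => ?_
  simp only [ha, hb, Matrix.diagonal_apply]
  split_ifs <;> subst_vars <;> first | contradiction | ring

theorem twistInv_stringSum {a b : Fin n} (hab : (a : ℕ) + 1 = b) (h : I → I → K)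
    (dA dB : I → K) (y : Matrix I I K)
    (hY : ∀ Y : I → I → I → I → K, (Y = fun x x' u u' =>
      y x u * Matrix.diagonal dB x' u' + Matrix.diagonal dA x u * y x' u') →
      ∀ x x' u u', Y x' x u u' + h x x' * Y x x' u u' = Y x x' u' u + Y x x' u u' * h u u') :
    TwistInv (fun l => l ∘ Equiv.swap a b) (fun l => h (l a) (l b))
      (stringSum n (Matrix.diagonal dA) y (Matrix.diagonal dB)) := by
  have hne : a ≠ b := by rintro rfl; omega
  rw [stringSum, ← Finset.add_sum_erase _ _ (Finset.mem_univ a),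
    ← Finset.add_sum_erase _ _ (Finset.mem_erase.mpr ⟨hne.symm, Finset.mem_univ b⟩), ← add_assoc]
  refine TwistInv.add ?_ (TwistInv.sum _ fun r hr => ?_)
  · refine twistInv_pair h _ _ (stringAt (Matrix.diagonal dA) y (Matrix.diagonal dB) a)
      (fun μ l => ?_) (hY _ rfl)
    rw [Matrix.add_apply, tens_eq_mul_mul hne, tens_eq_mul_mul hne, add_mul]
    have hlt : a < b := by rw [Fin.lt_def]; omega
    congr 1
    · congr 1
      simp [stringAt, hne.symm, hlt.not_gt]
    · have : ∀ r ∈ (Finset.univ.erase a).erase b,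
          stringAt (Matrix.diagonal dA) y (Matrix.diagonal dB) b r
            = stringAt (Matrix.diagonal dA) y (Matrix.diagonal dB) a r := by
        intro r hr
        rw [Finset.mem_erase, Finset.mem_erase] at hr
        have h1 : (r : ℕ) ≠ b := fun h => hr.1 (Fin.ext h)
        have h2 : (r : ℕ) ≠ a := fun h => hr.2.1 (Fin.ext h)
        have h3 : r < b ↔ r < a := by rw [Fin.lt_def, Fin.lt_def]; omega
        simp only [stringAt, h3, if_neg hr.1, if_neg hr.2.1]
      rw [Finset.prod_congr rfl fun r hr => by rw [this r hr]]
      congr 1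
      simp [stringAt, hlt]
  · rw [Finset.mem_erase, Finset.mem_erase] at hr
    have h1 : (r : ℕ) ≠ b := fun h => hr.1 (Fin.ext h)
    have h2 : (r : ℕ) ≠ a := fun h => hr.2.1 (Fin.ext h)
    rcases lt_or_ge (r : ℕ) a with hra | hra
    · refine twistInv_tens_diagonal hne h _ dB ?_ ?_
      · rw [stringAt, if_neg (by rw [Fin.lt_def]; omega), if_neg (fun h => h2 (congrArg _ h.symm))]
      · rw [stringAt, if_neg (by rw [Fin.lt_def]; omega), if_neg (fun h => h1 (congrArg _ h.symm))]
    · refine twistInv_tens_diagonal hne h _ dA ?_ ?_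
      · rw [stringAt, if_pos (by rw [Fin.lt_def]; omega)]
      · rw [stringAt, if_pos (by rw [Fin.lt_def]; omega)]

/-- A matrix acting in position `a` through `Y` and independently elsewhere commutes with an
operator in position `a` as soon as `Y` does. -/
theorem twistInv_one (a : Fin n) (ng : I → I) (h : I → K) (X : Matrix (Fin n → I) (Fin n → I) K)
    (Y : I → I → K) (z : Fin n → Matrix I I K)
    (hX : ∀ μ l, X μ l = Y (μ a) (l a) * ∏ r ∈ Finset.univ.erase a, z r (μ r) (l r))
    (hY : ∀ x u, Y (ng x) u + h x * Y x u = Y x (ng u) + Y x u * h u) :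
    TwistInv (fun l => Function.update l a (ng (l a))) (fun l => h (l a)) X := by
  intro μ l
  have hP : ∀ (μ l : Fin n → I) (x : I), ∏ r ∈ Finset.univ.erase a,
      z r (Function.update μ a x r) (l r) = ∏ r ∈ Finset.univ.erase a, z r (μ r) (l r) := by
    intro μ l x
    refine Finset.prod_congr rfl fun r hr => ?_
    rw [Function.update_of_ne (Finset.ne_of_mem_erase hr)]
  have hP' : ∀ (μ l : Fin n → I) (x : I), ∏ r ∈ Finset.univ.erase a,
      z r (μ r) (Function.update l a x r) = ∏ r ∈ Finset.univ.erase a, z r (μ r) (l r) := by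
    intro μ l x
    refine Finset.prod_congr rfl fun r hr => ?_
    rw [Function.update_of_ne (Finset.ne_of_mem_erase hr)]
  simp only [hX, hP, hP', Function.update_self]
  linear_combination (∏ r ∈ Finset.univ.erase a, z r (μ r) (l r)) * hY (μ a) (l a)

theorem twistInv_tens_sign (a : Fin n) (ng : I → I) (hng : Function.Involutive ng) (h : I → K)
    (z : Fin n → Matrix I I K) (d : I → K) (hd : ∀ x, d (ng x) = d x)
    (hz : z a = Matrix.diagonal d) :
    TwistInv (fun l => Function.update l a (ng (l a))) (fun l => h (l a)) (tens z) := by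
  refine twistInv_one a ng h _ (z a) z
    (fun μ l => (Finset.mul_prod_erase _ _ (Finset.mem_univ a)).symm) fun x u => ?_
  rw [hz]
  simp only [Matrix.diagonal_apply, hng.eq_iff, hd]
  by_cases hxu : x = u
  · subst hxu
    simp [mul_comm]
  · simp [hxu]

theorem twistInv_stringSum_sign (hn : 0 < n) (ng : I → I) (hng : Function.Involutive ng)
    (h : I → K) (d d' : I → K) (hd : ∀ x, d (ng x) = d x) (hd' : ∀ x, d' (ng x) = d' x)
    (y y' B : Matrix I I K)
    (hY : ∀ x u, (y + y') (ng x) u + h x * (y + y') x u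
      = (y + y') x (ng u) + (y + y') x u * h u) :
    TwistInv (fun l => Function.update l ⟨0, hn⟩ (ng (l ⟨0, hn⟩))) (fun l => h (l ⟨0, hn⟩))
      (stringSum n (Matrix.diagonal d) y B + stringSum n (Matrix.diagonal d') y' B) := by
  have hpos : ∀ r ∈ Finset.univ.erase (⟨0, hn⟩ : Fin n), (⟨0, hn⟩ : Fin n) < r := by
    intro r hr
    have : (r : ℕ) ≠ 0 := fun h => Finset.ne_of_mem_erase hr (Fin.ext h)
    rw [Fin.lt_def]
    exact Nat.pos_of_ne_zero this
  rw [stringSum, stringSum, ← Finset.add_sum_erase _ _ (Finset.mem_univ ⟨0, hn⟩),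
    ← Finset.add_sum_erase Finset.univ (fun r => tens (stringAt (Matrix.diagonal d') y' B r))
      (Finset.mem_univ ⟨0, hn⟩), add_add_add_comm]
  refine TwistInv.add ?_ (TwistInv.add (TwistInv.sum _ fun r hr => ?_)
    (TwistInv.sum _ fun r hr => ?_))
  · refine twistInv_one ⟨0, hn⟩ ng h _ (y + y') (fun _ => B) (fun μ l => ?_) hY
    have : ∀ (d : I → K) (y : Matrix I I K), tens (stringAt (Matrix.diagonal d) y B ⟨0, hn⟩) μ l
        = y (μ ⟨0, hn⟩) (l ⟨0, hn⟩)
          * ∏ r ∈ Finset.univ.erase (⟨0, hn⟩ : Fin n), B (μ r) (l r) := by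
      intro d y
      rw [tens, ← Finset.mul_prod_erase _ _ (Finset.mem_univ (⟨0, hn⟩ : Fin n))]
      refine congrArg₂ _ (by rw [stringAt, if_neg (lt_irrefl _), if_pos rfl])
        (Finset.prod_congr rfl fun r hr => ?_)
      rw [stringAt, if_neg (hpos r hr).not_gt, if_neg (Finset.ne_of_mem_erase hr)]
    rw [Matrix.add_apply, this, this, Matrix.add_apply, add_mul]
  · exact twistInv_tens_sign _ ng hng h _ d hd (by rw [stringAt, if_pos (hpos r hr)])
  · exact twistInv_tens_sign _ ng hng h _ d' hd' (by rw [stringAt, if_pos (hpos r hr)])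

end Invariance

/-- The integer value of an element of `𝕀_{2m+1}`. -/
def ival {M : ℕ} (x : SubI M) : ℤ := x.1.num

theorem ival_cast {m : ℕ} (x : SubI (2 * m + 1)) : x.1 = ival x := by
  obtain ⟨z, -, h⟩ := exists_int_of_mem_II x.2
  rw [ival, h, Rat.num_intCast]

theorem ival_injective {m : ℕ} : Function.Injective (ival (M := 2 * m + 1)) := fun x y h =>
  Subtype.ext (by rw [ival_cast x, ival_cast y, h])

theorem ival_negS {M : ℕ} (x : SubI M) : ival (negS x) = -ival x := Rat.neg_num x.1

theorem ival_idx {m : ℕ} {z : ℤ} (h : |z| ≤ m) : ival (idx m z) = z := by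
  rw [ival, idx_val h, Rat.num_intCast]

/-- The matrix algebra equivalence given by the standard basis of `V^{⊗n}`. -/
def matEquiv (n M : ℕ) :
    Module.End K (TV n M) ≃ₐ[K] Matrix (Fin n → SubI M) (Fin n → SubI M) K :=
  LinearMap.toMatrixAlgEquiv Finsupp.basisSingleOne

theorem matEquiv_apply {n M : ℕ} (O : Module.End K (TV n M)) (μ l : Fin n → SubI M) :
    matEquiv n M O μ l = O (Finsupp.single l 1) μ := by
  rw [matEquiv, LinearMap.toMatrixAlgEquiv_apply]
  simp

/-- The matrix of a single-target operator. -/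
def opMat {M : ℕ} (o : SOp) : Matrix (SubI M) (SubI M) K :=
  fun x u => if x.1 = o.t u.1 then o.c u.1 else 0

theorem matEquiv_tensorOp {n M : ℕ} (ops : Fin n → SOp) :
    matEquiv n M (tensorOp ops) = tens fun r => opMat (ops r) := by
  ext μ l
  rw [matEquiv_apply, tensorOp, Finsupp.lift_apply, Finsupp.sum_single_index (by simp), one_smul]
  by_cases h : ∀ r, (μ r).1 = (ops r).t (l r).1
  · have h' : ∀ r, (ops r).t (l r).1 ∈ II M := fun r => h r ▸ (μ r).2
    rw [dif_pos h']
    have hμ : (fun r => (⟨(ops r).t (l r).1, h' r⟩ : SubI M)) = μ :=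
      funext fun r => Subtype.ext (h r).symm
    rw [hμ, Finsupp.single_eq_same]
    exact Finset.prod_congr rfl fun r _ => (if_pos (h r)).symm
  · obtain ⟨r, hr⟩ := not_forall.mp h
    have h0 : tens (fun r => opMat (M := M) (ops r)) μ l = 0 :=
      Finset.prod_eq_zero (Finset.mem_univ r) (if_neg hr)
    rw [h0]
    split_ifs with h'
    · refine Finsupp.single_eq_of_ne fun hμ => hr ?_
      rw [hμ]
    · rfl

theorem opMat_diagonal {M : ℕ} (o : SOp) (ho : o.t = fun a => a) :
    opMat (M := M) o = Matrix.diagonal fun u => o.c u.1 := by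
  ext x u
  rw [opMat, ho, Matrix.diagonal_apply]
  by_cases h : x = u
  · simp [h]
  · rw [if_neg h, if_neg fun h' => h (Subtype.ext h')]

/-- The matrix unit of `F_{p+1/2}`. -/
def raiseMat (m : ℕ) (p : ℤ) : Matrix (SubI (2 * m + 1)) (SubI (2 * m + 1)) K :=
  fun x u => if ival x = p + 1 ∧ ival u = p then 1 else 0

/-- The scalar arising from commuting `E_{-i}` past `K_i⁻¹` for `i = p + 1/2`. -/
def lowCoef (p : ℤ) : K := if p = 0 then q⁻¹ else if p = -1 then q else 1

/-- The matrix of the middle factor in the second sum of `𝓑_{p+1/2}`. -/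
def lowMat (m : ℕ) (p : ℤ) : Matrix (SubI (2 * m + 1)) (SubI (2 * m + 1)) K :=
  fun x u => if ival x = -p - 1 ∧ ival u = -p then lowCoef p else 0

/-- The matrix of `K_{p+1/2}⁻¹`. -/
def kapMat (m : ℕ) (p : ℤ) : Matrix (SubI (2 * m + 1)) (SubI (2 * m + 1)) K :=
  Matrix.diagonal fun u => kap p (ival u)

/-- The matrix of `k_{p+1/2}⁻¹`. -/
def kapRatioMat (m : ℕ) (p : ℤ) : Matrix (SubI (2 * m + 1)) (SubI (2 * m + 1)) K :=
  Matrix.diagonal fun u => kap p (ival u) * (kap (-p - 1) (ival u))⁻¹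

/-- The matrix of `𝓑_{p+1/2}`. -/
def calBMat (m n : ℕ) (p : ℤ) :
    Matrix (Fin n → SubI (2 * m + 1)) (Fin n → SubI (2 * m + 1)) K :=
  stringSum n 1 (raiseMat m p) (kapMat m p)
    + stringSum n (kapRatioMat m p) (lowMat m p) (kapMat m p)

theorem half_eq_iff {p u : ℤ} {i : ℚ} (hi : i = p + 1 / 2) :
    ((u : ℚ) = i + 1 / 2 ↔ u = p + 1) ∧ ((u : ℚ) = i - 1 / 2 ↔ u = p) ∧
    ((u : ℚ) = -i + 1 / 2 ↔ u = -p) ∧ ((u : ℚ) = -i - 1 / 2 ↔ u = -p - 1) := by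
  subst hi
  have h : ∀ z : ℤ, (u : ℚ) = z ↔ u = z := fun z => Int.cast_inj
  rw [← h, ← h, ← h, ← h]
  push_cast
  refine ⟨?_, ?_, ?_, ?_⟩ <;> ring_nf

theorem opMat_id {M : ℕ} : opMat (M := M) SOp.id' = 1 := by
  rw [opMat_diagonal _ rfl]; rfl

theorem Kinv_c {p u : ℤ} {i : ℚ} (hi : i = p + 1 / 2) : (Kinv i).c (u : ℚ) = kap p u := by
  simp only [Kinv, diagOp, (half_eq_iff hi).1, (half_eq_iff hi).2.1, kap]
  split_ifs <;> first | omega | simp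

theorem Kpos_c {p u : ℤ} {i : ℚ} (hi : i = p + 1 / 2) :
    (Kpos i).c (u : ℚ) = (kap p u)⁻¹ := by
  simp only [Kpos, diagOp, (half_eq_iff hi).1, (half_eq_iff hi).2.1, kap]
  split_ifs <;> first | omega | simp

theorem neg_half {p : ℤ} {i : ℚ} (hi : i = p + 1 / 2) : -i = ((-p - 1 : ℤ) : ℚ) + 1 / 2 := by
  rw [hi]; push_cast; ring

theorem opMat_Kinv {m : ℕ} {p : ℤ} {i : ℚ} (hi : i = p + 1 / 2) :
    opMat (Kinv i) = kapMat m p := by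
  rw [opMat_diagonal _ rfl, kapMat]
  congr 1
  funext u
  rw [ival_cast u, Kinv_c hi]

theorem opMat_kinv {m : ℕ} {p : ℤ} {i : ℚ} (hi : i = p + 1 / 2) :
    opMat (kinv i) = kapRatioMat m p := by
  rw [opMat_diagonal _ rfl, kapRatioMat]
  congr 1
  funext u
  rw [ival_cast u, ← Kinv_c hi, ← Kpos_c (neg_half hi), mul_comm ((Kinv i).c _)]
  rfl

theorem opMat_kpos {m : ℕ} {p : ℤ} {i : ℚ} (hi : -i = p + 1 / 2) :
    opMat (kpos i) = kapRatioMat m p := by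
  rw [opMat_diagonal _ rfl, kapRatioMat]
  congr 1
  funext u
  have hi' := neg_half hi
  rw [neg_neg] at hi'
  rw [ival_cast u, ← Kinv_c hi, ← Kpos_c hi']
  rfl

theorem opMat_Fop {m : ℕ} {p : ℤ} {i : ℚ} (hi : i = p + 1 / 2) :
    opMat (Fop i) = raiseMat m p := by
  ext x u
  simp only [opMat, Fop, raiseMat, ival_cast x, ival_cast u, (half_eq_iff hi).2.1]
  have h : ((ival x : ℚ) = (ival u : ℚ) + 1) ↔ ival x = ival u + 1 := by
    exact_mod_cast Iff.rfl
  simp only [h]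
  split_ifs <;> first | rfl | omega

theorem opMat_Eop_comp_Kinv {m : ℕ} {p : ℤ} (hp : 0 ≤ p) {i : ℚ} (hi : i = p + 1 / 2) :
    opMat ((Eop (-i)).comp (Kinv i)) = lowMat m p := by
  ext x u
  have hc := Kinv_c (u := ival u) hi
  have ht : (Kinv i).t = fun a => a := rfl
  simp only [opMat, SOp.comp, Eop, ht]
  rw [ival_cast x, ival_cast u, hc]
  simp only [lowMat, (half_eq_iff hi).2.2.1, kap, lowCoef]
  have h : ((ival x : ℚ) = (ival u : ℚ) - 1) ↔ ival x = ival u - 1 := by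
    exact_mod_cast Iff.rfl
  simp only [h]
  split_ifs <;> first | omega | simp

theorem opMat_Kinv_comp_Eop {m : ℕ} {p : ℤ} (hp : p < 0) {i : ℚ} (hi : -i = p + 1 / 2) :
    opMat ((Kinv (-i)).comp (Eop i)) = lowMat m p := by
  ext x u
  have hc := Kinv_c (u := ival u - 1) hi
  have ht : (Kinv (-i)).t = fun a => a := rfl
  have hi' := half_eq_iff (u := ival u) hi
  rw [neg_neg] at hi'
  simp only [opMat, SOp.comp, Eop, ht]
  push_cast at hc
  rw [ival_cast x, ival_cast u, hc]
  simp only [lowMat, hi'.2.2.1, kap, lowCoef]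
  have h : ((ival x : ℚ) = (ival u : ℚ) - 1) ↔ ival x = ival u - 1 := by
    exact_mod_cast Iff.rfl
  simp only [h]
  split_ifs <;> first | omega | simp

theorem matEquiv_stringSum {n M : ℕ} (A y B : SOp) :
    matEquiv n M (∑ r : Fin n, tensorOp fun s => if s < r then A else if s = r then y else B)
      = stringSum n (opMat A) (opMat y) (opMat B) := by
  rw [map_sum, stringSum]
  refine Finset.sum_congr rfl fun r _ => ?_
  rw [matEquiv_tensorOp]
  congr 1
  funext s
  simp only [stringAt, apply_ite (opMat (M := M))]

theorem matEquiv_calB {m n a : ℕ} :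
    matEquiv n (2 * m + 1) (calB n (2 * m + 1) (a + 1 / 2)) = calBMat m n a := by
  have hi : (a : ℚ) + 1 / 2 = ((a : ℤ) : ℚ) + 1 / 2 := by push_cast; rfl
  rw [calB, map_add, matEquiv_stringSum, matEquiv_stringSum, opMat_id, opMat_Fop hi,
    opMat_Kinv hi, opMat_kinv hi, opMat_Eop_comp_Kinv (by omega) hi, calBMat]

theorem matEquiv_calBn {m n a : ℕ} :
    matEquiv n (2 * m + 1) (calBn n (2 * m + 1) (a + 1 / 2)) = calBMat m n (-a - 1) := by
  have hi : -((a : ℚ) + 1 / 2) = ((-a - 1 : ℤ) : ℚ) + 1 / 2 := by push_cast; ring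
  rw [calBn, map_add, matEquiv_stringSum, matEquiv_stringSum, opMat_id, opMat_Fop hi,
    opMat_Kinv hi, opMat_kpos hi, opMat_Kinv_comp_Eop (by omega) hi, calBMat]

/-- The matrix of `v_l ↦ v_{s l} + h(l) v_l`. -/
def twistMat {ι : Type*} {R : Type*} [CommRing R] (s : ι → ι) (h : ι → R) : Matrix ι ι R :=
  fun μ l => (if μ = s l then 1 else 0) + (if μ = l then h l else 0)

theorem commute_twistMat_iff {ι : Type*} [Fintype ι] {s : ι → ι} (hs : Function.Involutive s)
    (h : ι → K) (X : Matrix ι ι K) : X * twistMat s h = twistMat s h * X ↔ TwistInv s h X := by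
  have h1 : ∀ μ l, (X * twistMat s h) μ l = X μ (s l) + X μ l * h l := by
    intro μ l
    simp [Matrix.mul_apply, twistMat, mul_add, Finset.sum_add_distrib]
  have h2 : ∀ μ l, (twistMat s h * X) μ l = X (s μ) l + h μ * X μ l := by
    intro μ l
    simp [Matrix.mul_apply, twistMat, add_mul, Finset.sum_add_distrib, ← hs.eq_iff]
  refine ⟨fun hX μ l => ?_, fun hX => ?_⟩
  · rw [← h1, ← h2, hX]
  · ext μ l
    rw [h1, h2, hX]

theorem swap_involutive {n : ℕ} {I : Type} (a b : Fin n) :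
    Function.Involutive fun l : Fin n → I => l ∘ Equiv.swap a b := fun l => by
  funext r
  simp

theorem flip_involutive {n : ℕ} {I : Type} (a : Fin n) {ng : I → I}
    (hng : Function.Involutive ng) :
    Function.Involutive fun l : Fin n → I => Function.update l a (ng (l a)) := fun l => by
  simp [hng (l a)]

theorem single_one_apply {ι : Type*} (a b : ι) :
    (Finsupp.single a 1 : ι →₀ K) b = if b = a then 1 else 0 := by
  rw [Finsupp.single_apply]
  simp only [eq_comm]

theorem matEquiv_sigmaI {n m : ℕ} (a b : Fin n) :
    matEquiv n (2 * m + 1) (sigmaI a b) = twistMat (fun l => l ∘ Equiv.swap a b)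
      (fun l => hePair (ival (l a)) (ival (l b))) := by
  ext μ l
  rw [matEquiv_apply, sigmaI, Finsupp.lift_apply, Finsupp.sum_single_index (by simp), one_smul]
  simp only [ival_cast, Int.cast_lt, Int.cast_inj, twistMat, hePair, tT]
  have hsw : swapL a b l = l ∘ Equiv.swap a b := rfl
  rcases lt_trichotomy (ival (l a)) (ival (l b)) with h | h | h
  · rw [if_pos h, if_pos h, single_one_apply, hsw, ite_self, add_zero]
  · have hs : l ∘ Equiv.swap a b = l := by
      funext r
      have hl := ival_injective h
      rw [Function.comp_apply, Equiv.swap_apply_def]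
      split_ifs with h1 h2
      · rw [h1, hl]
      · rw [h2, hl]
      · rfl
    rw [if_neg h.not_lt, if_neg h.not_lt, if_pos h, if_pos h, Finsupp.smul_apply,
      single_one_apply]
    simp only [hs]
    split_ifs <;> simp
  · rw [if_neg h.not_gt, if_neg h.not_gt, if_neg h.ne', if_neg h.ne', Finsupp.add_apply,
      Finsupp.smul_apply, single_one_apply, single_one_apply, hsw, smul_eq_mul, mul_ite, mul_one,
      mul_zero]

theorem matEquiv_sigma0 {n m : ℕ} (hn : 0 < n) :
    matEquiv n (2 * m + 1) (sigma0 hn) = twistMat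
      (fun l : Fin n → SubI (2 * m + 1) => Function.update l ⟨0, hn⟩ (negS (l ⟨0, hn⟩)))
      (fun l => heSign (ival (l ⟨0, hn⟩))) := by
  ext μ l
  rw [matEquiv_apply, sigma0, Finsupp.lift_apply, Finsupp.sum_single_index (by simp), one_smul]
  simp only [ival_cast, Int.cast_pos, Int.cast_eq_zero, twistMat, heSign, tT]
  rcases lt_trichotomy 0 (ival (l ⟨0, hn⟩)) with h | h | h
  · rw [if_pos h, if_pos h, single_one_apply, ite_self, add_zero]
  · have hs : Function.update l ⟨0, hn⟩ (negS (l ⟨0, hn⟩)) = l := by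
      rw [Function.update_eq_self_iff]
      exact ival_injective (by rw [ival_negS, ← h, neg_zero])
    rw [if_neg h.not_lt, if_neg h.not_lt, if_pos h.symm, if_pos h.symm, Finsupp.smul_apply,
      single_one_apply]
    simp only [hs]
    split_ifs <;> simp
  · rw [if_neg h.not_gt, if_neg h.not_gt, if_neg h.ne, if_neg h.ne, Finsupp.add_apply,
      Finsupp.smul_apply, single_one_apply, single_one_apply, smul_eq_mul, mul_ite, mul_one,
      mul_zero]

theorem twistInv_calBMat_pair {m n : ℕ} (p : ℤ) {a b : Fin n} (hab : (a : ℕ) + 1 = b) :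
    TwistInv (fun l => l ∘ Equiv.swap a b)
      (fun l => hePair (ival (l a)) (ival (l b))) (calBMat m n p) := by
  refine TwistInv.add ?_ ?_
  · rw [← Matrix.diagonal_one, kapMat]
    refine twistInv_stringSum hab (fun x y => hePair (ival x) (ival y)) _ _ _ fun Y hY => ?_
    intro x y u v
    have := raise_pair q_ne_zero p (ival x) (ival y) (ival u) (ival v) _ rfl
    subst hY
    simpa only [raiseMat, Matrix.diagonal_apply, ← ival_injective.eq_iff] using this
  · rw [kapRatioMat, kapMat]
    refine twistInv_stringSum hab (fun x y => hePair (ival x) (ival y)) _ _ _ fun Y hY => ?_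
    intro x y u v
    have := lower_pair q_ne_zero (kap p) (lowCoef p) p (ival x) (ival y) (ival u) (ival v) _ rfl
    subst hY
    simpa only [lowMat, Matrix.diagonal_apply, ← ival_injective.eq_iff] using this

theorem kap_ratio_neg (p u : ℤ) :
    kap p (-u) * (kap (-p - 1) (-u))⁻¹ = kap p u * (kap (-p - 1) u)⁻¹ := by
  have hq' : q * q⁻¹ = 1 := mul_inv_cancel₀ q_ne_zero
  have hq : (q⁻¹)⁻¹ = q := inv_inv q
  simp only [kap]
  split_ifs <;> first | omega | rfl | (simp only [hq, inv_one, mul_one, one_mul])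

theorem twistInv_calBMat_sign {m n : ℕ} (p : ℤ) (hn : 0 < n) :
    TwistInv (fun l : Fin n → SubI (2 * m + 1) => Function.update l ⟨0, hn⟩ (negS (l ⟨0, hn⟩)))
      (fun l => heSign (ival (l ⟨0, hn⟩))) (calBMat m n p) := by
  rw [calBMat, ← Matrix.diagonal_one, kapRatioMat]
  refine twistInv_stringSum_sign hn negS negS_involutive (fun x => heSign (ival x)) _ _
    (fun _ => rfl) (fun x => ?_) _ _ _ fun x u => ?_
  · rw [ival_negS, kap_ratio_neg]
  · have := sign_pair q_ne_zero p (ival x) (ival u) _ rfl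
    simpa only [Matrix.add_apply, raiseMat, lowMat, ival_negS, lowCoef] using this

/-- The diagonal operator `(D_r^{e'} D_{-r}^{e'})^{⊗n}` with arbitrary exponent function. -/
def weightMat (m n : ℕ) (f : ℤ → ℤ) :
    Matrix (Fin n → SubI (2 * m + 1)) (Fin n → SubI (2 * m + 1)) K :=
  tens fun _ => Matrix.diagonal fun u => q ^ f (ival u)

theorem matEquiv_calD {m n : ℕ} (r : ℤ) (e : ℤ) :
    matEquiv n (2 * m + 1) (calD n (2 * m + 1) r e)
      = weightMat m n fun u => e * ((if u = r then 1 else 0) + (if u = -r then 1 else 0)) := by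
  rw [calD, matEquiv_tensorOp, weightMat]
  congr 1
  funext s
  rw [opMat_diagonal _ rfl]
  congr 1
  funext u
  have h : (u.1 = -(r : ℚ)) ↔ ival u = -r := by rw [ival_cast u]; exact_mod_cast Iff.rfl
  have h' : (u.1 = (r : ℚ)) ↔ ival u = r := by rw [ival_cast u]; exact_mod_cast Iff.rfl
  simp only [DDop, diagOp, h, h']

theorem matEquiv_calD0 {m n : ℕ} (e : ℤ) :
    matEquiv n (2 * m + 1) (calD0 n (2 * m + 1) e)
      = weightMat m n fun u => e * (if u = 0 then 1 else 0) := by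
  rw [calD0, matEquiv_tensorOp, weightMat]
  congr 1
  funext s
  rw [opMat_diagonal _ rfl]
  congr 1
  funext u
  have h' : (u.1 = 0) ↔ ival u = 0 := by rw [ival_cast u]; exact_mod_cast Iff.rfl
  simp only [D0op, diagOp, h']

/-- The matrices of the generators of the coideal algebra, by integer labels. -/
theorem matEquiv_gensAj_cases {m n : ℕ} {O : Module.End K (TV n (2 * m + 1))}
    (hO : O ∈ gensAj m n) : (∃ p, matEquiv n (2 * m + 1) O = calBMat m n p) ∨
      ∃ f : ℤ → ℤ, (∀ u, f (-u) = f u) ∧ matEquiv n (2 * m + 1) O = weightMat m n f := by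
  have hD : ∀ r ∈ II (2 * m + 1), ∀ e, ∃ f : ℤ → ℤ, (∀ u, f (-u) = f u) ∧
      matEquiv n (2 * m + 1) (calD n (2 * m + 1) r e) = weightMat m n f := by
    intro r hr e
    obtain ⟨z, -, rfl⟩ := exists_int_of_mem_II hr
    refine ⟨_, fun u => ?_, matEquiv_calD z e⟩
    simp only [neg_eq_iff_eq_neg, neg_neg]
    rw [add_comm]
  have hD0 : ∀ e, ∃ f : ℤ → ℤ, (∀ u, f (-u) = f u) ∧
      matEquiv n (2 * m + 1) (calD0 n (2 * m + 1) e) = weightMat m n f := fun e =>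
    ⟨_, fun u => by simp only [neg_eq_zero], matEquiv_calD0 e⟩
  rcases hO with ⟨i, hi, hpos, h⟩ | rfl | rfl | ⟨r, hr, -, rfl | rfl⟩
  · obtain ⟨a, -, rfl⟩ := exists_nat_of_mem_II_even hi hpos
    rcases h with rfl | rfl
    · exact Or.inl ⟨_, matEquiv_calB⟩
    · exact Or.inl ⟨_, matEquiv_calBn⟩
  · exact Or.inr (hD0 1)
  · exact Or.inr (hD0 (-1))
  · exact Or.inr (hD r hr 1)
  · exact Or.inr (hD r hr (-1))

theorem commute_sigmaB {m n : ℕ} (hn : 0 < n) {a s : Module.End K (TV n (2 * m + 1))}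
    (ha : a ∈ gensAj m n) (hs : s ∈ gensH n (2 * m + 1) hn) : Commute a s := by
  obtain ⟨i, hi, rfl⟩ := hs
  refine (matEquiv n (2 * m + 1)).injective ?_
  rw [map_mul, map_mul, sigmaB]
  split_ifs with h0
  · rw [matEquiv_sigma0, commute_twistMat_iff (flip_involutive _ negS_involutive)]
    rcases matEquiv_gensAj_cases ha with ⟨p, h⟩ | ⟨f, hf, h⟩
    · rw [h]
      exact twistInv_calBMat_sign p hn
    · rw [h]
      exact twistInv_tens_sign _ negS negS_involutive (fun x => heSign (ival x)) _ _
        (fun x => by simp only [ival_negS, hf]) rfl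
  · rw [matEquiv_sigmaI, commute_twistMat_iff (swap_involutive _ _)]
    have hab : ((⟨i - 1, by omega⟩ : Fin n) : ℕ) + 1 = (⟨i, hi⟩ : Fin n) :=
      Nat.sub_add_cancel (Nat.pos_of_ne_zero h0)
    rcases matEquiv_gensAj_cases ha with ⟨p, h⟩ | ⟨f, hf, h⟩
    · rw [h]
      exact twistInv_calBMat_pair p hab
    · rw [h]
      refine twistInv_tens_diagonal (fun h => ?_) (fun x y => hePair (ival x) (ival y)) _ _ rfl rfl
      rw [h] at hab
      omega

section Specialization

variable {ι : Type*}

theorem HasMatValue.one [DecidableEq ι] : HasMatValue (1 : Matrix ι ι K) 1 := fun i j => by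
  rw [Matrix.one_apply, Matrix.one_apply]
  split_ifs
  · exact HasValue.one
  · exact HasValue.zero

theorem HasMatValue.add {X X' : Matrix ι ι K} {Y Y' : Matrix ι ι ℚ} (h : HasMatValue X Y)
    (h' : HasMatValue X' Y') : HasMatValue (X + X') (Y + Y') := fun i j => (h i j).add (h' i j)

theorem HasMatValue.sum {α : Type*} (s : Finset α) {X : α → Matrix ι ι K} {Y : α → Matrix ι ι ℚ}
    (h : ∀ a ∈ s, HasMatValue (X a) (Y a)) : HasMatValue (∑ a ∈ s, X a) (∑ a ∈ s, Y a) := by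
  intro i j
  rw [Matrix.sum_apply, Matrix.sum_apply]
  exact HasValue.sum s fun a ha => h a ha i j

theorem HasMatValue.mul [Fintype ι] {X X' : Matrix ι ι K} {Y Y' : Matrix ι ι ℚ}
    (h : HasMatValue X Y) (h' : HasMatValue X' Y') : HasMatValue (X * X') (Y * Y') := by
  intro i j
  rw [Matrix.mul_apply, Matrix.mul_apply]
  exact HasValue.sum _ fun a _ => (h i a).mul (h' a j)

theorem HasMatValue.unique {X : Matrix ι ι K} {Y Y' : Matrix ι ι ℚ} (h : HasMatValue X Y)
    (h' : HasMatValue X Y') : Y = Y' := by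
  ext i j
  exact (h i j).unique (h' i j)

theorem HasMatValue.diagonal [DecidableEq ι] {d : ι → K} (h : ∀ u, HasValue (d u) 1) :
    HasMatValue (Matrix.diagonal d) 1 := fun i j => by
  rw [Matrix.diagonal_apply, Matrix.one_apply]
  split_ifs
  · exact h i
  · exact HasValue.zero

/-- The values at `q = 1` of the regular elements of an algebra of matrices. -/
def specialize [Fintype ι] [DecidableEq ι] (W : Subalgebra K (Matrix ι ι K)) :
    Subalgebra ℚ (Matrix ι ι ℚ) where
  carrier := {Y | ∃ X ∈ W, HasMatValue X Y}
  mul_mem' := by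
    rintro _ _ ⟨X, hX, h⟩ ⟨X', hX', h'⟩
    exact ⟨X * X', W.mul_mem hX hX', h.mul h'⟩
  add_mem' := by
    rintro _ _ ⟨X, hX, h⟩ ⟨X', hX', h'⟩
    exact ⟨X + X', W.add_mem hX hX', h.add h'⟩
  algebraMap_mem' c := by
    refine ⟨algebraMap K _ (algebraMap ℚ K c), W.algebraMap_mem _, fun i j => ?_⟩
    rw [Matrix.algebraMap_matrix_apply, Matrix.algebraMap_matrix_apply]
    split_ifs
    · exact HasValue.rat c
    · exact HasValue.zero

/-- Mutually centralizing algebras whose specializations are large are each other's commutants. -/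
theorem centralizer_le_of_specialize [Fintype ι] [DecidableEq ι]
    {W W' : Subalgebra K (Matrix ι ι K)}
    (hcomm : W ≤ Subalgebra.centralizer K W')
    (h : ∀ Y, (∀ b ∈ specialize W', b * Y = Y * b) → Y ∈ specialize W) :
    Subalgebra.centralizer K W' ≤ W := by
  refine le_of_hasMatValue (Subalgebra.toSubmodule W)
    (Subalgebra.toSubmodule (Subalgebra.centralizer K W')) hcomm ?_
  intro X hX Y hXY
  refine h Y ?_
  rintro b ⟨X', hX', hb⟩
  have h1 := Subalgebra.mem_centralizer_iff K |>.mp hX X' hX'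
  have h2 := hb.mul hXY
  rw [h1] at h2
  exact h2.unique (hXY.mul hb)

end Specialization

section TensorValues

variable {n : ℕ} {I : Type}

theorem hasMatValue_tens {z : Fin n → Matrix I I K} {y : Fin n → Matrix I I ℚ}
    (h : ∀ r, HasMatValue (z r) (y r)) : HasMatValue (tens z) (tens y) := fun μ l =>
  HasValue.prod _ fun r _ => h r (μ r) (l r)

theorem hasMatValue_stringSum {A z B : Matrix I I K} {y : Matrix I I ℚ} (hA : HasMatValue A 1)
    (hz : HasMatValue z y) (hB : HasMatValue B 1) :
    HasMatValue (stringSum n A z B) (deriv1 n y) := by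
  refine HasMatValue.sum _ fun r _ => hasMatValue_tens fun s => ?_
  rw [stringAt]
  split_ifs with h1 h2
  · rwa [Function.update_of_ne h1.ne]
  · rwa [h2, Function.update_self]
  · rwa [Function.update_of_ne h2]

theorem deriv1_diagonal_self (f : I → ℚ) (l : Fin n → I) :
    deriv1 n (Matrix.diagonal f) l l = ∑ r, f (l r) := by
  rw [deriv1, Matrix.sum_apply]
  refine Finset.sum_congr rfl fun r _ => ?_
  rw [tens_update_apply, Matrix.diagonal_apply_eq, Finset.prod_eq_one, mul_one]
  intro s _
  exact Matrix.one_apply_eq _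

theorem deriv1_diagonal_of_ne (f : I → ℚ) {μ l : Fin n → I} (h : μ ≠ l) :
    deriv1 n (Matrix.diagonal f) μ l = 0 := by
  obtain ⟨s, hs⟩ := Function.ne_iff.mp h
  rw [deriv1, Matrix.sum_apply]
  refine Finset.sum_eq_zero fun r _ => Finset.prod_eq_zero (Finset.mem_univ s) ?_
  rcases eq_or_ne s r with rfl | hsr
  · rw [Function.update_self, Matrix.diagonal_apply_ne _ hs]
  · rw [Function.update_of_ne hsr, Matrix.one_apply_ne hs]

end TensorValues

section GeneratorValues

variable {m n : ℕ}

theorem hasValue_kap (p u : ℤ) : HasValue (kap p u) 1 := by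
  rw [kap]
  split_ifs
  · exact HasValue.indeterminate
  · exact HasValue.q_inv
  · exact HasValue.one

theorem hasValue_kap_inv (p u : ℤ) : HasValue (kap p u)⁻¹ 1 := by
  rw [kap]
  split_ifs
  · exact HasValue.q_inv
  · rw [inv_inv]; exact HasValue.indeterminate
  · rw [inv_one]; exact HasValue.one

theorem hasValue_lowCoef (p : ℤ) : HasValue (lowCoef p) 1 := by
  rw [lowCoef]
  split_ifs
  · exact HasValue.q_inv
  · exact HasValue.indeterminate
  · exact HasValue.one

theorem hasValue_hePair (u v : ℤ) : HasValue (hePair u v) 0 := by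
  rw [hePair]
  split_ifs
  · exact HasValue.zero
  · simpa using HasValue.q_inv.sub HasValue.one
  · simpa using HasValue.q_inv.sub HasValue.indeterminate

theorem hasValue_heSign (u : ℤ) : HasValue (heSign u) 0 := by
  rw [heSign]
  split_ifs
  · exact HasValue.zero
  · simpa using HasValue.q_inv.sub HasValue.one
  · simpa using HasValue.q_inv.sub HasValue.indeterminate

theorem eq_idx_iff {x : SubI (2 * m + 1)} {z : ℤ} (h : |z| ≤ m) : idx m z = x ↔ ival x = z := by
  rw [← ival_injective.eq_iff, ival_idx h, eq_comm]

theorem single_idx_apply {a b : ℤ} (ha : |a| ≤ m) (hb : |b| ≤ m) (x u : SubI (2 * m + 1)) :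
    Matrix.single (idx m a) (idx m b) (1 : ℚ) x u = if ival x = a ∧ ival u = b then 1 else 0 := by
  simp only [Matrix.single_apply, eq_idx_iff ha, eq_idx_iff hb]

theorem hasMatValue_calBMat {p : ℤ} (hp : |p| ≤ m) (hp' : |p + 1| ≤ m) :
    HasMatValue (calBMat m n p) (deriv1 n (sgnUnit m (p + 1) p)) := by
  have hlin : deriv1 n (sgnUnit m (p + 1) p)
      = deriv1 n (Matrix.single (idx m (p + 1)) (idx m p) (1 : ℚ))
        + deriv1 n (Matrix.single (idx m (-(p + 1))) (idx m (-p)) (1 : ℚ)) := by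
    rw [sgnUnit_eq hp' hp]
    exact map_add (derivLin n _ ℚ) _ _
  have hB : HasMatValue (kapMat m p) 1 := HasMatValue.diagonal fun u => hasValue_kap _ _
  rw [hlin, calBMat]
  refine (hasMatValue_stringSum HasMatValue.one (fun x u => ?_) hB).add
    (hasMatValue_stringSum (HasMatValue.diagonal fun u => ?_) (fun x u => ?_) hB)
  · rw [single_idx_apply hp' hp, raiseMat]
    split_ifs
    · exact HasValue.one
    · exact HasValue.zero
  · simpa using (hasValue_kap p (ival u)).mul (hasValue_kap_inv (-p - 1) (ival u))
  · rw [single_idx_apply (by rwa [abs_neg]) (by rwa [abs_neg]), lowMat, neg_add']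
    split_ifs
    · exact hasValue_lowCoef p
    · exact HasValue.zero

theorem hasMatValue_weightMat (f : ℤ → ℕ) :
    HasMatValue ((q - 1)⁻¹ • (weightMat m n (fun u => f u) - 1))
      (deriv1 n (Matrix.diagonal fun u => (f (ival u) : ℚ))) := by
  intro μ l
  rw [Matrix.smul_apply, Matrix.sub_apply, smul_eq_mul, weightMat, tens]
  rcases eq_or_ne μ l with rfl | h
  · rw [deriv1_diagonal_self, Matrix.one_apply_eq]
    simp only [Matrix.diagonal_apply_eq, zpow_natCast, Finset.prod_pow_eq_pow_sum]
    simpa using HasValue.q_pow_sub_one_div (∑ r, f (ival (μ r)))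
  · obtain ⟨s, hs⟩ := Function.ne_iff.mp h
    have h0 : ∏ r, Matrix.diagonal (fun u : SubI (2 * m + 1) => q ^ ((f (ival u) : ℕ) : ℤ))
        (μ r) (l r) = 0 :=
      Finset.prod_eq_zero (Finset.mem_univ s) (Matrix.diagonal_apply_ne _ hs)
    rw [deriv1_diagonal_of_ne _ h, Matrix.one_apply_ne h, h0, sub_zero, mul_zero]
    exact HasValue.zero

theorem deriv1_signedUnit_mem_specialize
    (W : Subalgebra K (Matrix (Fin n → SubI (2 * m + 1)) (Fin n → SubI (2 * m + 1)) K))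
    (hW : ∀ O ∈ gensAj m n, matEquiv n (2 * m + 1) O ∈ W) (a b : SubI (2 * m + 1)) :
    deriv1 n (signedUnit negS a b) ∈ specialize W := by
  have hweight : ∀ f : ℤ → ℕ, weightMat m n (fun u => f u) ∈ W →
      deriv1 n (Matrix.diagonal fun u => (f (ival u) : ℚ)) ∈ specialize W := fun f hf =>
    ⟨_, W.smul_mem (W.sub_mem hf W.one_mem) _, hasMatValue_weightMat f⟩
  refine signedUnit_mem ((Subalgebra.toSubmodule (specialize W)).comap (derivLin n _ ℚ))
    ?_ ?_ ?_ ?_ a b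
  · intro x hx y hy
    change deriv1 n (x * y - y * x) ∈ specialize W
    rw [← deriv1_commutator]
    exact sub_mem (mul_mem hx hy) (mul_mem hy hx)
  · intro a ha
    have ha' : |(a : ℤ)| ≤ m := by rw [abs_of_nonneg (by omega)]; omega
    have hna : |-(a : ℤ)| ≤ m := by rwa [abs_neg]
    change deriv1 n (sgnUnit m a a) ∈ specialize W
    rcases Nat.eq_zero_or_pos a with rfl | hpos
    · have h0 := hweight (fun u => if u = 0 then 1 else 0) (by
        have := hW _ (Or.inr (Or.inl rfl))
        rw [matEquiv_calD0] at this
        simpa using this)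
      have h1 : sgnUnit m (0 : ℕ) (0 : ℕ) = (2 : ℚ) • Matrix.diagonal fun u : SubI (2 * m + 1) =>
          (((if ival u = 0 then 1 else 0 : ℕ)) : ℚ) := by
        ext x u
        rw [sgnUnit_eq ha' ha', Matrix.add_apply, single_idx_apply ha' ha',
          single_idx_apply hna hna, Matrix.smul_apply, Matrix.diagonal_apply]
        by_cases hxu : x = u
        · subst hxu
          by_cases hx : ival x = 0 <;> simp [hx]; norm_num
        · have : ¬(ival x = 0 ∧ ival u = 0) := fun h =>
            hxu (ival_injective (h.1.trans h.2.symm))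
          simp [hxu, this]
      rw [h1]
      have h2 := map_smul (derivLin n (SubI (2 * m + 1)) ℚ) (2 : ℚ)
        (Matrix.diagonal fun u => (((if ival u = 0 then 1 else 0 : ℕ)) : ℚ))
      change deriv1 n _ = _ at h2
      rw [h2]
      exact (specialize W).smul_mem h0 _
    · have h0 := hweight (fun u => (if u = a then 1 else 0) + (if u = -a then 1 else 0)) (by
        have := hW _ (Or.inr (Or.inr (Or.inr ⟨((a : ℤ) : ℚ), intCast_mem_II ha',
          by exact_mod_cast hpos, Or.inl rfl⟩)))
        rw [matEquiv_calD] at this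
        simpa using this)
      have h1 : sgnUnit m a a = Matrix.diagonal fun u : SubI (2 * m + 1) =>
          (((if ival u = a then 1 else 0) + (if ival u = -a then 1 else 0) : ℕ) : ℚ) := by
        ext x u
        rw [sgnUnit_eq ha' ha', Matrix.add_apply, single_idx_apply ha' ha',
          single_idx_apply hna hna, Matrix.diagonal_apply]
        by_cases hxu : x = u
        · subst hxu
          simp
        · have h3 : ∀ z, ¬(ival x = z ∧ ival u = z) := fun z h =>
            hxu (ival_injective (h.1.trans h.2.symm))
          simp [hxu, h3]
      rw [h1]
      exact h0
  · intro a ha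
    refine ⟨calBMat m n a, ?_, hasMatValue_calBMat ?_ ?_⟩
    · rw [← matEquiv_calB]
      exact hW _ (Or.inl ⟨_, half_mem_II ha, by positivity, Or.inl rfl⟩)
    · rw [abs_of_nonneg (by omega)]; omega
    · rw [abs_of_nonneg (by omega)]; omega
  · intro a ha
    refine ⟨calBMat m n (-a - 1), ?_, ?_⟩
    · rw [← matEquiv_calBn]
      exact hW _ (Or.inl ⟨_, half_mem_II ha, by positivity, Or.inr rfl⟩)
    · have h1 : |(-(a : ℤ) - 1)| ≤ m := by rw [abs_le]; omega
      have h2 : |(-(a : ℤ) - 1 + 1)| ≤ m := by rw [abs_le]; omega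
      have := hasMatValue_calBMat (n := n) h1 h2
      rw [← sgnUnit_neg h2 h1] at this
      have h3 : -(-(a : ℤ) - 1 + 1) = a := by ring
      have h4 : -(-(a : ℤ) - 1) = a + 1 := by ring
      rw [h3, h4] at this
      exact this

end GeneratorValues

section SignedPermutations

variable {n : ℕ} {I : Type}

theorem invariant_of_commute_twistMat {ι : Type*} [Fintype ι] {s : ι → ι}
    (hs : Function.Involutive s) {X : Matrix ι ι ℚ}
    (h : X * twistMat s 0 = twistMat s 0 * X) (μ l : ι) : X (s μ) (s l) = X μ l := by
  have h1 := congrFun (congrFun h (s μ)) l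
  simpa [Matrix.mul_apply, twistMat, hs μ, hs.injective.eq_iff] using h1

theorem transpose_twistMat {ι : Type*} {s : ι → ι} (hs : Function.Involutive s) :
    (twistMat s 0 : Matrix ι ι ℚ).transpose = twistMat s 0 := by
  ext μ l
  simp [twistMat, ← hs.eq_iff (y := l), eq_comm]

/-- Invariance under adjacent transpositions implies invariance under all permutations. -/
theorem perm_invariant {R : Type} {X : Matrix (Fin n → I) (Fin n → I) R}
    (h : ∀ a b : Fin n, (a : ℕ) + 1 = b → ∀ μ l,
      X (μ ∘ Equiv.swap a b) (l ∘ Equiv.swap a b) = X μ l) (π : Equiv.Perm (Fin n))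
    (μ l : Fin n → I) : X (μ ∘ π) (l ∘ π) = X μ l := by
  cases n with
  | zero => congr 1 <;> exact Subsingleton.elim _ _
  | succ k =>
    let S : Submonoid (Equiv.Perm (Fin (k + 1))) :=
      { carrier := {π | ∀ μ l : Fin (k + 1) → I, X (μ ∘ π) (l ∘ π) = X μ l}
        one_mem' := fun μ l => rfl
        mul_mem' := fun {π τ} hπ hτ μ l => by
          have := hτ (μ ∘ π) (l ∘ π)
          rw [hπ] at this
          exact this }
    have hS : S = ⊤ := by
      rw [eq_top_iff, ← Equiv.Perm.mclosure_swap_castSucc_succ k, Submonoid.closure_le]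
      rintro _ ⟨i, rfl⟩
      exact h _ _ (by simp)
    have hπ : π ∈ S := hS ▸ Submonoid.mem_top π
    exact hπ μ l

/-- Invariance under permutations and one sign change implies invariance under all sign changes. -/
theorem sign_invariant {R : Type} {X : Matrix (Fin n → I) (Fin n → I) R} (ng : I → I) (a : Fin n)
    (hperm : ∀ (π : Equiv.Perm (Fin n)) (μ l : Fin n → I), X (μ ∘ π) (l ∘ π) = X μ l)
    (hflip : ∀ μ l, X (Function.update μ a (ng (μ a))) (Function.update l a (ng (l a))) = X μ l)
    (t : Finset (Fin n)) (μ l : Fin n → I) :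
    X (fun r => if r ∈ t then μ r else ng (μ r)) (fun r => if r ∈ t then l r else ng (l r))
      = X μ l := by
  have hconj : ∀ (b : Fin n) (l : Fin n → I), Function.update l b (ng (l b))
      = Function.update (l ∘ Equiv.swap a b) a (ng ((l ∘ Equiv.swap a b) a))
        ∘ Equiv.swap a b := by
    intro b l
    funext r
    rcases eq_or_ne r b with rfl | hr
    · simp
    · have h1 : Equiv.swap a b r ≠ a := fun h => hr (by
        have := congrArg (Equiv.swap a b) h
        rwa [Equiv.swap_apply_self, Equiv.swap_apply_left] at this)
      simp [Function.update_of_ne hr, Function.update_of_ne h1]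
  have hflip' : ∀ (b : Fin n) (μ l : Fin n → I),
      X (Function.update μ b (ng (μ b))) (Function.update l b (ng (l b))) = X μ l := by
    intro b μ l
    rw [hconj b μ, hconj b l, hperm, hflip, hperm]
  have key : ∀ (t : Finset (Fin n)), X (fun r => if r ∈ t then ng (μ r) else μ r)
      (fun r => if r ∈ t then ng (l r) else l r) = X μ l := by
    intro t
    induction t using Finset.induction_on with
    | empty => simp
    | insert b t hb ih =>
      rw [← ih, ← hflip' b (fun r => if r ∈ t then ng (μ r) else μ r)]
      have h1 : ∀ l : Fin n → I, (fun r => if r ∈ insert b t then ng (l r) else l r)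
          = Function.update (fun r => if r ∈ t then ng (l r) else l r) b
            (ng (if b ∈ t then ng (l b) else l b)) := by
        intro l
        funext r
        rcases eq_or_ne r b with rfl | hr
        · simp [hb]
        · simp [hr]
      rw [h1, h1]
  rw [← key tᶜ]
  simp only [Finset.mem_compl, ite_not]

end SignedPermutations

section HeckeAction

variable {m n : ℕ}

/-- The place permutation or sign change underlying `σ_i`. -/
def placeAction {M : ℕ} (hn : 0 < n) (i : ℕ) (hi : i < n) (l : Fin n → SubI M) : Fin n → SubI M :=
  if i = 0 then Function.update l ⟨0, hn⟩ (negS (l ⟨0, hn⟩))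
  else l ∘ Equiv.swap ⟨i - 1, by omega⟩ ⟨i, hi⟩

theorem placeAction_involutive {M : ℕ} (hn : 0 < n) (i : ℕ) (hi : i < n) :
    Function.Involutive (placeAction (M := M) hn i hi) := by
  rcases eq_or_ne i 0 with h | h
  · have : placeAction (M := M) hn i hi
        = fun l : Fin n → SubI M => Function.update l ⟨0, hn⟩ (negS (l ⟨0, hn⟩)) :=
      funext fun l => if_pos h
    rw [this]
    exact flip_involutive _ negS_involutive
  · have : placeAction (M := M) hn i hi
        = fun l : Fin n → SubI M => l ∘ Equiv.swap ⟨i - 1, by omega⟩ ⟨i, hi⟩ :=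
      funext fun l => if_neg h
    rw [this]
    exact swap_involutive _ _

theorem hasMatValue_twistMat {ι : Type*} (s : ι → ι) (h : ι → K) (hh : ∀ l, HasValue (h l) 0) :
    HasMatValue (twistMat s h) (twistMat s 0) := by
  intro μ l
  rw [twistMat, twistMat]
  refine HasValue.add ?_ ?_
  · split_ifs
    · exact HasValue.one
    · exact HasValue.zero
  · rw [Pi.zero_apply, ite_self]
    split_ifs
    · exact hh l
    · exact HasValue.zero

theorem hasMatValue_sigmaB (hn : 0 < n) (i : ℕ) (hi : i < n) :
    HasMatValue (matEquiv n (2 * m + 1) (sigmaB hn i hi)) (twistMat (placeAction hn i hi) 0) := by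
  rcases eq_or_ne i 0 with h | h
  · have : placeAction (M := 2 * m + 1) hn i hi
        = fun l : Fin n → SubI (2 * m + 1) => Function.update l ⟨0, hn⟩ (negS (l ⟨0, hn⟩)) :=
      funext fun l => if_pos h
    rw [this, sigmaB, if_pos h, matEquiv_sigma0]
    exact hasMatValue_twistMat _ _ fun l => hasValue_heSign _
  · have : placeAction (M := 2 * m + 1) hn i hi
        = fun l : Fin n → SubI (2 * m + 1) => l ∘ Equiv.swap ⟨i - 1, by omega⟩ ⟨i, hi⟩ :=
      funext fun l => if_neg h
    rw [this, sigmaB, if_neg h, matEquiv_sigmaI]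
    exact hasMatValue_twistMat _ _ fun l => hasValue_hePair _ _

/-- The algebra generated by the place permutations and sign changes. -/
def placeAlgebra (m : ℕ) (hn : 0 < n) :
    Subalgebra ℚ (Matrix (Fin n → SubI (2 * m + 1)) (Fin n → SubI (2 * m + 1)) ℚ) :=
  Algebra.adjoin ℚ {Y | ∃ i : ℕ, ∃ hi : i < n, Y = twistMat (placeAction hn i hi) 0}

theorem transpose_mem_placeAlgebra (hn : 0 < n)
    (Y : Matrix (Fin n → SubI (2 * m + 1)) (Fin n → SubI (2 * m + 1)) ℚ)
    (hY : Y ∈ placeAlgebra m hn) : Y.transpose ∈ placeAlgebra m hn := by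
  induction hY using Algebra.adjoin_induction with
  | mem x hx =>
    obtain ⟨i, hi, rfl⟩ := hx
    rw [transpose_twistMat (placeAction_involutive hn i hi)]
    exact Algebra.subset_adjoin ⟨i, hi, rfl⟩
  | algebraMap c =>
    rw [Matrix.algebraMap_eq_diagonal, Matrix.diagonal_transpose, ← Matrix.algebraMap_eq_diagonal]
    exact Subalgebra.algebraMap_mem _ c
  | add x y _ _ hx hy =>
    rw [Matrix.transpose_add]
    exact add_mem hx hy
  | mul x y _ _ hx hy =>
    rw [Matrix.transpose_mul]
    exact mul_mem hy hx

theorem mem_specialize_of_commute_placeAlgebra (hn : 0 < n)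
    (W : Subalgebra K (Matrix (Fin n → SubI (2 * m + 1)) (Fin n → SubI (2 * m + 1)) K))
    (hW : ∀ O ∈ gensAj m n, matEquiv n (2 * m + 1) O ∈ W)
    (Y : Matrix (Fin n → SubI (2 * m + 1)) (Fin n → SubI (2 * m + 1)) ℚ)
    (hY : ∀ b ∈ placeAlgebra m hn, b * Y = Y * b) : Y ∈ specialize W := by
  have hinv : ∀ (i : ℕ) (hi : i < n) μ l,
      Y (placeAction hn i hi μ) (placeAction hn i hi l) = Y μ l := fun i hi =>
    invariant_of_commute_twistMat (placeAction_involutive hn i hi)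
      (hY _ (Algebra.subset_adjoin ⟨i, hi, rfl⟩)).symm
  have hperm := perm_invariant (X := Y) (by
    rintro ⟨a, ha⟩ ⟨b, hb⟩ hab μ l
    obtain rfl : a + 1 = b := hab
    have := hinv (a + 1) hb μ l
    simpa only [placeAction, if_neg (Nat.succ_ne_zero a), Nat.add_sub_cancel] using this)
  refine mem_of_invariant negS negS_involutive _ (deriv1_signedUnit_mem_specialize W hW) Y hperm
    (sign_invariant negS ⟨0, hn⟩ hperm fun μ l => ?_)
  have := hinv 0 hn μ l
  simpa only [placeAction, if_true] using this

theorem placeAlgebra_le_specialize (hn : 0 < n)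
    (W : Subalgebra K (Matrix (Fin n → SubI (2 * m + 1)) (Fin n → SubI (2 * m + 1)) K))
    (hW : ∀ O ∈ gensH n (2 * m + 1) hn, matEquiv n (2 * m + 1) O ∈ W) :
    placeAlgebra m hn ≤ specialize W := by
  refine Algebra.adjoin_le ?_
  rintro _ ⟨i, hi, rfl⟩
  exact ⟨_, hW _ ⟨i, hi, rfl⟩, hasMatValue_sigmaB hn i hi⟩

end HeckeAction

section DoubleCentralizer

/-- Subalgebras generated by commuting sets commute. -/
theorem adjoin_le_centralizer_adjoin {R A : Type*} [CommRing R] [Ring A] [Algebra R A]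
    {S T : Set A} (h : ∀ a ∈ S, ∀ s ∈ T, Commute a s) :
    Algebra.adjoin R S ≤ Subalgebra.centralizer R (Algebra.adjoin R T : Set A) := by
  refine Algebra.adjoin_le fun a ha => Subalgebra.mem_centralizer_iff R |>.mpr fun b hb => ?_
  have hT : Algebra.adjoin R T ≤ Subalgebra.centralizer R {a} := by
    refine Algebra.adjoin_le fun s hs => Subalgebra.mem_centralizer_iff R |>.mpr ?_
    rintro _ rfl
    exact (h _ ha s hs).eq
  exact (Subalgebra.mem_centralizer_iff R |>.mp (hT hb) a rfl).symm

/-- `centralizer_le_of_specialize`, transported to endomorphisms of `V^{⊗n}`. -/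
theorem centralizer_adjoin_eq {n M : ℕ} {S T : Set (Module.End K (TV n M))}
    (hST : ∀ a ∈ S, ∀ s ∈ T, Commute a s)
    (h : ∀ Y, (∀ b ∈ specialize ((Algebra.adjoin K T).map (matEquiv n M).toAlgHom),
      b * Y = Y * b) → Y ∈ specialize ((Algebra.adjoin K S).map (matEquiv n M).toAlgHom)) :
    Subalgebra.centralizer K (Algebra.adjoin K T : Set (Module.End K (TV n M)))
      = Algebra.adjoin K S := by
  have hle := adjoin_le_centralizer_adjoin (R := K) (A := Module.End K (TV n M)) hST
  refine le_antisymm (fun X hX => ?_) hle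
  have h1 := centralizer_le_of_specialize ?_ h
  · have h2 : matEquiv n M X ∈ Subalgebra.centralizer K
        ((Algebra.adjoin K T).map (matEquiv n M).toAlgHom :
          Set (Matrix (Fin n → SubI M) (Fin n → SubI M) K)) := by
      rw [Subalgebra.mem_centralizer_iff]
      rintro _ ⟨Z, hZ, rfl⟩
      have h3 := Subalgebra.mem_centralizer_iff K |>.mp hX Z hZ
      change matEquiv n M Z * matEquiv n M X = matEquiv n M X * matEquiv n M Z
      rw [← map_mul, h3, map_mul]
    obtain ⟨Z, hZ, hZX⟩ := h1 h2
    rwa [← (matEquiv n M).injective hZX]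
  · rintro _ ⟨Z, hZ, rfl⟩
    rw [Subalgebra.mem_centralizer_iff]
    rintro _ ⟨Z', hZ', rfl⟩
    have h3 := Subalgebra.mem_centralizer_iff K |>.mp (hle hZ) Z' hZ'
    change matEquiv n M Z' * matEquiv n M Z = matEquiv n M Z * matEquiv n M Z'
    rw [← map_mul, h3, map_mul]

end DoubleCentralizer

theorem stmt8 (m n : ℕ) (hn : 0 < n) :
    -- (1) each U^ȷ_m-operator commutes with each σ_i
    (∀ a ∈ gensAj m n, ∀ s ∈ gensH n (2*m+1) hn, Commute a s) ∧
    -- (2) the commutant of the algebra generated by the U^ȷ_m-operators is the Hecke algebra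
    Subalgebra.centralizer K
        ((Algebra.adjoin K (gensAj m n) : Subalgebra K (Module.End K (TV n (2*m+1)))) : Set (Module.End K (TV n (2*m+1))))
      = Algebra.adjoin K (gensH n (2*m+1) hn) ∧
    -- (3) the commutant of the Hecke algebra is the algebra generated by the U^ȷ_m-operators
    Subalgebra.centralizer K
        ((Algebra.adjoin K (gensH n (2*m+1) hn) : Subalgebra K (Module.End K (TV n (2*m+1)))) : Set (Module.End K (TV n (2*m+1))))
      = Algebra.adjoin K (gensAj m n) := by
  have hcomm : ∀ a ∈ gensAj m n, ∀ s ∈ gensH n (2*m+1) hn, Commute a s :=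
    fun a ha s hs => commute_sigmaB hn ha hs
  have hmem : ∀ (S : Set (Module.End K (TV n (2*m+1)))), ∀ O ∈ S, matEquiv n (2*m+1) O ∈
      (Algebra.adjoin K S).map (matEquiv n (2*m+1)).toAlgHom := fun S O hO =>
    ⟨O, Algebra.subset_adjoin hO, rfl⟩
  have hH := placeAlgebra_le_specialize hn _ (hmem (gensH n (2*m+1) hn))
  have hA := mem_specialize_of_commute_placeAlgebra hn _ (hmem (gensAj m n))
  refine ⟨hcomm, centralizer_adjoin_eq (fun s hs a ha => (hcomm a ha s hs).symm) fun Y hY => ?_,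
    centralizer_adjoin_eq hcomm fun Y hY => hA Y fun b hb => hY b (hH hb)⟩
  refine hH (mem_of_commutes_with_commutant _ (transpose_mem_placeAlgebra hn) Y fun g hg => ?_)
  exact (hY g (hA g hg)).symm

end
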